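/- Let $d \ge 2$, $0 < s$ with $s \ne \frac{1}{2}$, $\beta > -d$, and $0 \le \theta \le \min\left\{\frac{d+\beta}{2s}, \frac{d}{2}\right\}$. There is a constant $C = C(d, s, \beta, \theta)$ such that for every $t \ne 0$ and every Schwartz function $u_0$ on $\mathbb{R}^d$ whose Fourier transform is supported in the ball $\{\xi : |\xi| \le 2\}$: $\|(-\Delta)^{\beta/2} e^{-it(-\Delta)^s} u_0\|_{L^\infty(\mathbb{R}^d)} \le C\, |t|^{-\theta}\, \|u_0\|_{L^1(\mathbb{R}^d)}$. -/

import Mathlib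

open MeasureTheory Complex
open scoped ENNReal BigOperators RealInnerProductSpace

noncomputable section

abbrev Ed (d : ℕ) := EuclideanSpace ℝ (Fin d)

/-- Fourier transform with convention `(𝓕 f) ξ = ∫ e^{-i x·ξ} f x dx`. -/
def FT {d : ℕ} (f : Ed d → ℂ) (ξ : Ed d) : ℂ :=
  ∫ x : Ed d, Complex.exp (-Complex.I * ((⟪x, ξ⟫ : ℝ) : ℂ)) * f x

/-- Inverse Fourier transform `(2π)^{-d} ∫ e^{i x·ξ} g ξ dξ`. -/
def FTinv {d : ℕ} (g : Ed d → ℂ) (x : Ed d) : ℂ :=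
  (((2 * Real.pi) ^ (-(d : ℝ)) : ℝ) : ℂ) *
    ∫ ξ : Ed d, Complex.exp (Complex.I * ((⟪x, ξ⟫ : ℝ) : ℂ)) * g ξ

/-- Fractional Schrödinger propagator `e^{-it(-Δ)^s}`. -/
def fprop {d : ℕ} (s t : ℝ) (f : Ed d → ℂ) : Ed d → ℂ :=
  FTinv (fun ξ => Complex.exp (-Complex.I * (t : ℂ) * ((‖ξ‖ ^ (2 * s) : ℝ) : ℂ)) * FT f ξ)

/-- Fractional derivative `D^σ = (-Δ)^{σ/2}`, the Fourier multiplier `|ξ|^σ`. -/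
def fracD {d : ℕ} (σ : ℝ) (f : Ed d → ℂ) : Ed d → ℂ :=
  FTinv (fun ξ => ((‖ξ‖ ^ σ : ℝ) : ℂ) * FT f ξ)

/-- `(-Δ)^{β/2} e^{-it(-Δ)^s}`. -/
def fracDProp {d : ℕ} (β s t : ℝ) (f : Ed d → ℂ) : Ed d → ℂ :=
  FTinv (fun ξ => ((‖ξ‖ ^ β : ℝ) : ℂ) *
    Complex.exp (-Complex.I * (t : ℂ) * ((‖ξ‖ ^ (2 * s) : ℝ) : ℂ)) * FT f ξ)

/-- Resolvent `(-Δ + λ)⁻¹`. -/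
def resolv {d : ℕ} (lam : ℝ) (f : Ed d → ℂ) : Ed d → ℂ :=
  FTinv (fun ξ => FT f ξ / ((‖ξ‖ ^ 2 + lam : ℝ) : ℂ))

/-- Resolvent-regularization `u_λ = √(sin(πs)/π) (-Δ+λ)⁻¹ u`. -/
def reg {d : ℕ} (s lam : ℝ) (f : Ed d → ℂ) : Ed d → ℂ :=
  fun x => ((Real.sqrt (Real.sin (Real.pi * s) / Real.pi) : ℝ) : ℂ) * resolv lam f x

/-- A function is radial if its value depends only on `|x|`. -/
def IsRadial {d : ℕ} (f : Ed d → ℂ) : Prop :=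
  ∀ x y : Ed d, ‖x‖ = ‖y‖ → f x = f y

/-- Homogeneous Sobolev norm `‖f‖_{Ḣ^s} = (2π)^{-d/2} ‖ |ξ|^s 𝓕f ‖_{L²}`. -/
def HdotNorm {d : ℕ} (s : ℝ) (f : Ed d → ℂ) : ℝ :=
  (2 * Real.pi) ^ (-(d : ℝ) / 2) *
    (eLpNorm (fun ξ : Ed d => ((‖ξ‖ ^ s : ℝ) : ℂ) * FT f ξ) 2 volume).toReal

/-- Inhomogeneous Sobolev norm `‖f‖_{H^s}² = ‖f‖_{L²}² + ‖f‖_{Ḣ^s}²`. -/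
def HNorm {d : ℕ} (s : ℝ) (f : Ed d → ℂ) : ℝ :=
  Real.sqrt ((eLpNorm f 2 volume).toReal ^ 2 + HdotNorm s f ^ 2)

/-- Mixed space-time norm `L^q_t L^r_x (ℝ × ℝ^d)`. -/
def mixedNorm {d : ℕ} (q r : ℝ≥0∞) (F : ℝ → Ed d → ℂ) : ℝ≥0∞ :=
  eLpNorm (fun t => (eLpNorm (F t) r volume).toReal) q volume

/-- Partial derivative `∂_j` of a complex-valued function. -/
def pd {d : ℕ} (j : Fin d) (f : Ed d → ℂ) (x : Ed d) : ℂ :=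
  fderiv ℝ f x (EuclideanSpace.single j 1)

/-- Partial derivative `∂_j` of a real-valued function. -/
def pdR {d : ℕ} (j : Fin d) (f : Ed d → ℝ) (x : Ed d) : ℝ :=
  fderiv ℝ f x (EuclideanSpace.single j 1)

/-- Laplacian of a real-valued function. -/
def lapR {d : ℕ} (f : Ed d → ℝ) : Ed d → ℝ :=
  fun x => ∑ j : Fin d, pdR j (pdR j f) x

/-- Rescaling `χ_R(x) = χ(x/R)`. -/
def chiR {d : ℕ} (χ : Ed d → ℝ) (R : ℝ) : Ed d → ℝ :=
  fun x => χ (R⁻¹ • x)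


/-- Squared `H^{1/2}` norm `(2π)^{-d} ∫ (1+|ξ|²)^{1/2} |𝓕u(ξ)|² dξ`. -/
def H12sq {d : ℕ} (f : Ed d → ℂ) : ℝ :=
  (2 * Real.pi) ^ (-(d : ℝ)) * ∫ ξ : Ed d, (1 + ‖ξ‖ ^ 2) ^ ((1 : ℝ)/2) * ‖FT f ξ‖ ^ 2


open scoped ContDiff Topology

section NonstationaryPhase

variable {P : Type*} [NormedAddCommGroup P] [NormedSpace ℝ P] {d : ℕ}

/-- The partial derivative in the `j`-th coordinate of the second variable. -/
def partialSnd {F : Type*} [NormedAddCommGroup F] [NormedSpace ℝ F] (j : Fin d)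
    (f : P × Ed d → F) (z : P × Ed d) : F :=
  fderiv ℝ f z (0, EuclideanSpace.single j 1)

/-- Amplitudes vanishing off `S` which are smooth at every point over `K`. -/
structure IsAmplitude (K : Set P) (S : Set (P × Ed d)) (a : P × Ed d → ℂ) : Prop where
  contDiffAt : ∀ z : P × Ed d, z.1 ∈ K → ContDiffAt ℝ ∞ a z
  eq_zero : ∀ z ∉ S, a z = 0

/-- A phase which is smooth without critical points in the second variable on the part of `S`
over `K`, this part having bounded second component. -/
structure IsNonstationary (K : Set P) (S : Set (P × Ed d)) (B : Set (Ed d))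
    (ψ : P × Ed d → ℝ) : Prop where
  isClosed : IsClosed S
  isCompact : IsCompact B
  mem : ∀ z ∈ S, z.1 ∈ K → z.2 ∈ B
  contDiffAt : ∀ z ∈ S, z.1 ∈ K → ContDiffAt ℝ ∞ ψ z
  fderiv_ne : ∀ z ∈ S, z.1 ∈ K → ∃ v : Ed d, fderiv ℝ ψ z (0, v) ≠ 0

lemma ContDiffAt.partialSnd {F : Type*} [NormedAddCommGroup F] [NormedSpace ℝ F] (j : Fin d)
    {f : P × Ed d → F} {z : P × Ed d} (hf : ContDiffAt ℝ ∞ f z) :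
    ContDiffAt ℝ ∞ (partialSnd j f) z :=
  (hf.fderiv_right (m := ∞) le_rfl).clm_apply contDiffAt_const

variable {K : Set P} {S : Set (P × Ed d)} {B : Set (Ed d)} {ψ : P × Ed d → ℝ}
  {a : P × Ed d → ℂ}

lemma IsAmplitude.of_contDiffAt (hS : IsClosed S) (hz : ∀ z ∉ S, a z = 0)
    (h : ∀ z ∈ S, z.1 ∈ K → ContDiffAt ℝ ∞ a z) : IsAmplitude K S a where
  eq_zero := hz
  contDiffAt z hzK := by
    by_cases hzS : z ∈ S
    · exact h z hzS hzK
    · refine (contDiffAt_const (c := (0 : ℂ))).congr_of_eventuallyEq ?_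
      filter_upwards [hS.isOpen_compl.mem_nhds hzS] with y hy using hz y hy

/-- The sum of the squares of the partial derivatives in the second variable. -/
def gradSndSq (ψ : P × Ed d → ℝ) (z : P × Ed d) : ℝ := ∑ j, partialSnd j ψ z ^ 2

lemma gradSndSq_ne_zero {z : P × Ed d} (h : ∃ v : Ed d, fderiv ℝ ψ z (0, v) ≠ 0) :
    gradSndSq ψ z ≠ 0 := by
  intro h0
  obtain ⟨v, hv⟩ := h
  have hj : ∀ j, partialSnd j ψ z = 0 := by
    intro j
    have := (Finset.sum_eq_zero_iff_of_nonneg (fun i _ => sq_nonneg (partialSnd i ψ z))).1 h0 j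
      (Finset.mem_univ j)
    simpa using this
  apply hv
  have hdec : ((0 : P), v) = ∑ j, v j • ((0 : P), (EuclideanSpace.single j 1 : Ed d)) := by
    apply Prod.ext
    · simp [Prod.fst_sum]
    · rw [Prod.snd_sum]
      ext i
      simp [Finset.sum_apply, Pi.single_apply]
  rw [hdec, map_sum]
  refine Finset.sum_eq_zero fun j _ => ?_
  rw [map_smul]
  have := hj j
  rw [partialSnd] at this
  rw [this, smul_zero]

/-- The components of the amplitude divided by the gradient of the phase. -/
def ampDiv (ψ : P × Ed d → ℝ) (a : P × Ed d → ℂ) (j : Fin d) (z : P × Ed d) : ℂ :=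
  a z * ((partialSnd j ψ z / gradSndSq ψ z : ℝ) : ℂ)

lemma IsAmplitude.ampDiv (hψ : IsNonstationary K S B ψ) (ha : IsAmplitude K S a) (j : Fin d) :
    IsAmplitude K S (ampDiv ψ a j) := by
  refine .of_contDiffAt hψ.isClosed (fun z hz => by simp [_root_.ampDiv, ha.eq_zero z hz])
    fun z hz hzK => ?_
  refine (ha.contDiffAt z hzK).mul (ofRealCLM.contDiff.contDiffAt.comp z ?_)
  have hψz := hψ.contDiffAt z hz hzK
  refine (hψz.partialSnd j).div ?_ (gradSndSq_ne_zero (hψ.fderiv_ne z hz hzK))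
  exact ContDiffAt.sum fun i _ => (hψz.partialSnd i).pow 2

lemma IsAmplitude.partialSnd (hS : IsClosed S) (ha : IsAmplitude K S a) (j : Fin d) :
    IsAmplitude K S (partialSnd j a) := by
  refine ⟨fun z hzK => (ha.contDiffAt z hzK).partialSnd j, fun z hz => ?_⟩
  have : a =ᶠ[𝓝 z] fun _ => 0 := by
    filter_upwards [hS.isOpen_compl.mem_nhds hz] with y hy using ha.eq_zero y hy
  simp [_root_.partialSnd, this.fderiv_eq]

lemma IsAmplitude.sum {ι : Type*} {t : Finset ι} {b : ι → P × Ed d → ℂ}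
    (hb : ∀ i, IsAmplitude K S (b i)) : IsAmplitude K S (fun z => ∑ i ∈ t, b i z) :=
  ⟨fun z hzK => ContDiffAt.sum fun i _ => (hb i).contDiffAt z hzK,
    fun z hz => Finset.sum_eq_zero fun i _ => (hb i).eq_zero z hz⟩

lemma IsAmplitude.cexp_mul (hψ : IsNonstationary K S B ψ) (ha : IsAmplitude K S a) (l : ℝ) :
    IsAmplitude K S (fun z => cexp (I * (l * ψ z : ℝ)) * a z) := by
  refine .of_contDiffAt hψ.isClosed (fun z hz => by simp [ha.eq_zero z hz]) fun z hz hzK => ?_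
  refine ContDiffAt.mul (ContDiffAt.cexp (contDiffAt_const.mul ?_)) (ha.contDiffAt z hzK)
  exact ofRealCLM.contDiff.contDiffAt.comp z (contDiffAt_const.mul (hψ.contDiffAt z hz hzK))

lemma IsAmplitude.hasCompactSupport (hψ : IsNonstationary K S B ψ) (ha : IsAmplitude K S a)
    {p : P} (hp : p ∈ K) : HasCompactSupport fun ξ => a (p, ξ) :=
  HasCompactSupport.intro hψ.isCompact fun _ hξ =>
    ha.eq_zero _ fun h => hξ (hψ.mem _ h hp)

lemma IsAmplitude.contDiff (ha : IsAmplitude K S a) {p : P} (hp : p ∈ K) :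
    ContDiff ℝ ∞ fun ξ => a (p, ξ) :=
  contDiff_iff_contDiffAt.2 fun ξ =>
    (ha.contDiffAt (p, ξ) hp).comp ξ (contDiffAt_const.prodMk contDiffAt_id)

lemma IsAmplitude.integrable (hψ : IsNonstationary K S B ψ) (ha : IsAmplitude K S a)
    {p : P} (hp : p ∈ K) : Integrable fun ξ => a (p, ξ) :=
  (ha.contDiff hp).continuous.integrable_of_hasCompactSupport (ha.hasCompactSupport hψ hp)

lemma integral_fderiv_eq_zero {w : Ed d → ℂ} (hw : ContDiff ℝ ∞ w) (hc : HasCompactSupport w)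
    (v : Ed d) : ∫ ξ, fderiv ℝ w ξ v = 0 := by
  have h := integral_mul_fderiv_eq_neg_fderiv_mul_of_integrable (μ := (volume : Measure (Ed d)))
    (f := fun _ => (1 : ℂ)) (g := w) (v := v) (by simp) ?_ ?_
    (fun _ _ => by fun_prop) (fun x _ => (hw.differentiable (by simp)).differentiableAt)
  · simpa using h
  · simp only [one_mul]
    refine Continuous.integrable_of_hasCompactSupport ?_ ?_
    · exact (hw.continuous_fderiv (by simp)).clm_apply continuous_const
    · exact (hc.fderiv (𝕜 := ℝ)).comp_left (g := fun L : Ed d →L[ℝ] ℂ => L v) rfl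
  · simpa using hw.continuous.integrable_of_hasCompactSupport hc

lemma IsAmplitude.integral_partialSnd (hψ : IsNonstationary K S B ψ) (ha : IsAmplitude K S a)
    {p : P} (hp : p ∈ K) (j : Fin d) : ∫ ξ, _root_.partialSnd j a (p, ξ) = 0 := by
  rw [← integral_fderiv_eq_zero (ha.contDiff hp) (ha.hasCompactSupport hψ hp)
    (EuclideanSpace.single j 1)]
  congr 1 with ξ
  have h1 : HasFDerivAt (fun ξ : Ed d => (p, ξ)) (ContinuousLinearMap.inr ℝ P (Ed d)) ξ :=
    hasFDerivAt_prodMk_right p ξ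
  have h2 := ((ha.contDiffAt (p, ξ) hp).differentiableAt (by simp)).hasFDerivAt.comp ξ h1
  have h3 := h2.fderiv
  change fderiv ℝ (fun ξ => a (p, ξ)) ξ = _ at h3
  rw [h3]
  simp [_root_.partialSnd]

/-- Integration by parts against a nonstationary phase. -/
lemma IsAmplitude.integral_by_parts (hψ : IsNonstationary K S B ψ) (ha : IsAmplitude K S a)
    {p : P} (hp : p ∈ K) (l : ℝ) :
    I * l * ∫ ξ, cexp (I * (l * ψ (p, ξ) : ℝ)) * a (p, ξ) =
      -∫ ξ, cexp (I * (l * ψ (p, ξ) : ℝ)) * ∑ j, _root_.partialSnd j (_root_.ampDiv ψ a j) (p, ξ) := by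
  have hw : ∀ j, IsAmplitude K S
      (fun z => cexp (I * (l * ψ z : ℝ)) * _root_.ampDiv ψ a j z) :=
    fun j => (ha.ampDiv hψ j).cexp_mul hψ l
  have hL : IsAmplitude K S fun z => ∑ j, _root_.partialSnd j (_root_.ampDiv ψ a j) z :=
    .sum fun j => (ha.ampDiv hψ j).partialSnd hψ.isClosed j
  have key : ∀ ξ, ∑ j, _root_.partialSnd j
        (fun z => cexp (I * (l * ψ z : ℝ)) * _root_.ampDiv ψ a j z) (p, ξ) =
      I * l * (cexp (I * (l * ψ (p, ξ) : ℝ)) * a (p, ξ)) +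
        cexp (I * (l * ψ (p, ξ) : ℝ)) * ∑ j, _root_.partialSnd j (_root_.ampDiv ψ a j) (p, ξ) := by
    intro ξ
    by_cases hz : (p, ξ) ∈ S
    · have hψz := ((hψ.contDiffAt _ hz hp).differentiableAt (by simp)).hasFDerivAt
      have hne := gradSndSq_ne_zero (hψ.fderiv_ne _ hz hp)
      have h1 : ∀ j, _root_.partialSnd j
          (fun z => cexp (I * (l * ψ z : ℝ)) * _root_.ampDiv ψ a j z) (p, ξ) =
          I * l * cexp (I * (l * ψ (p, ξ) : ℝ)) * a (p, ξ) *
            ((_root_.partialSnd j ψ (p, ξ) ^ 2 / gradSndSq ψ (p, ξ) : ℝ) : ℂ) +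
          cexp (I * (l * ψ (p, ξ) : ℝ)) * _root_.partialSnd j (_root_.ampDiv ψ a j) (p, ξ) := by
        intro j
        have hb := (((ha.ampDiv hψ j).contDiffAt (p, ξ) hp).differentiableAt (by simp)).hasFDerivAt
        have he : HasFDerivAt (fun z => cexp (I * (l * ψ z : ℝ))) _ (p, ξ) :=
          ((ofRealCLM.hasFDerivAt.comp (p, ξ) (hψz.const_mul l)).const_mul I).cexp
        have hm := (he.mul hb).fderiv
        rw [_root_.partialSnd, show (fun z => cexp (I * (l * ψ z : ℝ)) * _root_.ampDiv ψ a j z) =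
          (fun z => cexp (I * (l * ψ z : ℝ))) * _root_.ampDiv ψ a j from rfl, hm]
        simp only [add_apply, smul_apply,
          ContinuousLinearMap.comp_apply, smul_eq_mul, ofRealCLM_apply, Function.comp]
        simp only [_root_.partialSnd, _root_.ampDiv]
        push_cast
        ring
      rw [Finset.sum_congr rfl fun j _ => h1 j, Finset.sum_add_distrib, ← Finset.mul_sum,
        ← Finset.mul_sum, ← ofReal_sum, ← Finset.sum_div]
      rw [show (∑ i, _root_.partialSnd i ψ (p, ξ) ^ 2) = gradSndSq ψ (p, ξ) from rfl, div_self hne]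
      push_cast
      ring
    · rw [ha.eq_zero _ hz, hL.eq_zero _ hz]
      simp only [mul_zero, add_zero]
      exact Finset.sum_eq_zero fun j _ => ((hw j).partialSnd hψ.isClosed j).eq_zero _ hz
  have h0 : ∫ ξ, ∑ j, _root_.partialSnd j
        (fun z => cexp (I * (l * ψ z : ℝ)) * _root_.ampDiv ψ a j z) (p, ξ) = 0 := by
    rw [integral_finsetSum _ fun j _ => ((hw j).partialSnd hψ.isClosed j).integrable hψ hp]
    exact Finset.sum_eq_zero fun j _ => (hw j).integral_partialSnd hψ hp j
  simp_rw [key] at h0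
  rw [integral_add (((ha.cexp_mul hψ l).integrable hψ hp).const_mul _)
    ((hL.cexp_mul hψ l).integrable hψ hp), integral_const_mul] at h0
  exact eq_neg_of_add_eq_zero_left h0

/-- Uniform rapid decay of a compact family of nonstationary oscillatory integrals. -/
theorem IsAmplitude.norm_integral_le (hK : IsCompact K) (hψ : IsNonstationary K S B ψ) (N : ℕ)
    (ha : IsAmplitude K S a) :
    ∃ C : ℝ, 0 ≤ C ∧ ∀ p ∈ K, ∀ l : ℝ, l ≠ 0 →
      ‖∫ ξ, cexp (I * (l * ψ (p, ξ) : ℝ)) * a (p, ξ)‖ ≤ C / |l| ^ N := by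
  induction N generalizing a with
  | zero =>
    obtain ⟨M, hM⟩ := (hK.prod hψ.isCompact).exists_bound_of_continuousOn (f := a)
      fun z hz => (ha.contDiffAt z hz.1).continuousAt.continuousWithinAt
    refine ⟨|M| * volume.real B, by positivity, fun p hp l _ => ?_⟩
    rw [← setIntegral_eq_integral_of_forall_compl_eq_zero (s := B)]
    · rw [pow_zero, div_one]
      refine norm_setIntegral_le_of_norm_le_const hψ.isCompact.measure_lt_top fun ξ hξ => ?_
      rw [norm_mul, mul_comm I, norm_exp_ofReal_mul_I, one_mul]
      exact (hM (p, ξ) ⟨hp, hξ⟩).trans (le_abs_self M)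
    · intro ξ hξ
      rw [ha.eq_zero _ fun h => hξ (hψ.mem _ h hp), mul_zero]
  | succ N ih =>
    have hL : IsAmplitude K S fun z => ∑ j, _root_.partialSnd j (_root_.ampDiv ψ a j) z :=
      .sum fun j => (ha.ampDiv hψ j).partialSnd hψ.isClosed j
    obtain ⟨C, hC, h⟩ := ih hL
    refine ⟨C, hC, fun p hp l hl => ?_⟩
    have h1 := congrArg norm (ha.integral_by_parts hψ hp l)
    rw [norm_neg, norm_mul, norm_mul, norm_I, one_mul, norm_real, Real.norm_eq_abs] at h1
    have h2 := h p hp l hl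
    have hl' : 0 < |l| := abs_pos.2 hl
    rw [← h1, le_div_iff₀ (by positivity)] at h2
    rw [le_div_iff₀ (by positivity), pow_succ]
    linarith

end NonstationaryPhase

section OscillatoryIntegral

variable {d : ℕ}

/-- The annulus `1 ≤ |ξ| ≤ 4`. -/
def unitAnnulus (d : ℕ) : Set (Ed d) := {ξ | 1 ≤ ‖ξ‖ ∧ ‖ξ‖ ≤ 4}

lemma isClosed_unitAnnulus : IsClosed (unitAnnulus d) :=
  (isClosed_le continuous_const continuous_norm).inter
    (isClosed_le continuous_norm continuous_const)

lemma isCompact_unitAnnulus : IsCompact (unitAnnulus d) :=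
  (isCompact_closedBall (0 : Ed d) 4).of_isClosed_subset isClosed_unitAnnulus
    fun ξ hξ => by simpa using hξ.2

lemma ne_zero_of_mem_unitAnnulus {ξ : Ed d} (h : ξ ∈ unitAnnulus d) : ξ ≠ 0 := by
  rintro rfl
  have := h.1
  norm_num at this

/-- The oscillatory integral `∫ e^{i(x·ξ - t|ξ|^{2s})} a(ξ) dξ`. -/
def oscInt (s : ℝ) (a : Ed d → ℂ) (x : Ed d) (t : ℝ) : ℂ :=
  ∫ ξ, cexp (I * (⟪x, ξ⟫ - t * ‖ξ‖ ^ (2 * s) : ℝ)) * a ξ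

lemma norm_rpow_two_mul (s : ℝ) (ξ : Ed d) : ‖ξ‖ ^ (2 * s) = (‖ξ‖ ^ 2) ^ s := by
  rw [Real.rpow_mul (norm_nonneg ξ)]
  norm_num

lemma norm_sq_ne_zero {ξ : Ed d} (h : ξ ≠ 0) : ‖ξ‖ ^ 2 ≠ 0 := by simpa using h

lemma contDiffAt_norm_sq_rpow {F : Type*} [NormedAddCommGroup F] [NormedSpace ℝ F] {s : ℝ}
    {f : F → Ed d} {z : F} (hf : ContDiffAt ℝ ∞ f z) (h : f z ≠ 0) :
    ContDiffAt ℝ ∞ (fun z => (‖f z‖ ^ 2) ^ s) z :=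
  (hf.norm_sq ℝ).rpow_const_of_ne (norm_sq_ne_zero h)

lemma hasFDerivAt_norm_sq_rpow (s : ℝ) {ξ : Ed d} (h : ξ ≠ 0) :
    HasFDerivAt (fun ξ : Ed d => (‖ξ‖ ^ 2) ^ s)
      ((2 * s * (‖ξ‖ ^ 2) ^ (s - 1)) • innerSL ℝ ξ) ξ := by
  have h1 := ((hasStrictFDerivAt_norm_sq ξ).hasFDerivAt).rpow_const (p := s)
    (Or.inl (norm_sq_ne_zero h))
  have h2 : (s * (‖ξ‖ ^ 2) ^ (s - 1)) • 2 • innerSL ℝ ξ =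
      (2 * s * (‖ξ‖ ^ 2) ^ (s - 1)) • innerSL ℝ ξ := by
    ext v
    simp
    ring
  rw [h2] at h1
  exact h1

lemma fderiv_snd_apply {P : Type*} [NormedAddCommGroup P] [NormedSpace ℝ P]
    {ψ : P × Ed d → ℝ} {p : P} {ξ : Ed d} {L : Ed d →L[ℝ] ℝ} (hψ : DifferentiableAt ℝ ψ (p, ξ))
    (h : HasFDerivAt (fun ξ => ψ (p, ξ)) L ξ) (v : Ed d) : fderiv ℝ ψ (p, ξ) (0, v) = L v := by
  have h1 : HasFDerivAt (fun ξ : Ed d => (p, ξ)) (ContinuousLinearMap.inr ℝ P (Ed d)) ξ :=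
    hasFDerivAt_prodMk_right p ξ
  rw [h.unique (hψ.hasFDerivAt.comp ξ h1)]
  simp

lemma rpow_mem_of_mem_Icc {r : ℝ} (h1 : 1 ≤ r) (h4 : r ≤ 4) (e : ℝ) :
    4 ^ (-|e|) ≤ r ^ e ∧ r ^ e ≤ 4 ^ |e| := by
  have key : ∀ e : ℝ, r ^ e ≤ 4 ^ |e| := fun e =>
    (Real.rpow_le_rpow_of_exponent_le h1 (le_abs_self e)).trans
      (Real.rpow_le_rpow (by linarith) h4 (abs_nonneg e))
  refine ⟨?_, key e⟩
  have h := key (-e)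
  have hr : 0 < r := by linarith
  rw [abs_neg, Real.rpow_neg hr.le] at h
  rw [Real.rpow_neg (by norm_num)]
  exact inv_le_of_inv_le₀ (by positivity) h

lemma norm_rpow_smul (s : ℝ) {ξ : Ed d} (h : ξ ≠ 0) :
    ‖((‖ξ‖ ^ 2) ^ (s - 1)) • ξ‖ = ‖ξ‖ ^ (2 * s - 1) := by
  have h0 : 0 < ‖ξ‖ := norm_pos_iff.2 h
  rw [norm_smul, Real.norm_of_nonneg (by positivity), ← norm_rpow_two_mul]
  nth_rewrite 2 [← Real.rpow_one ‖ξ‖]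
  rw [← Real.rpow_add h0]
  ring_nf

/-- Away from the region where `|x|` and `|t|` are comparable, the oscillatory integral decays
rapidly. -/
lemma exists_oscInt_le_of_nonresonant {s : ℝ} (hs : 0 < s) {a : Ed d → ℂ} (ha : ContDiff ℝ ∞ a)
    (ha0 : ∀ ξ ∉ unitAnnulus d, a ξ = 0) :
    ∃ c₁ c₂ : ℝ, 0 < c₁ ∧ 0 < c₂ ∧ ∀ N : ℕ, ∃ C : ℝ, 0 ≤ C ∧ ∀ x t, t ≠ 0 →
      (‖x‖ ≤ c₁ * |t| ∨ c₂ * |t| ≤ ‖x‖) → ‖oscInt s a x t‖ ≤ C / |t| ^ N := by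
  set c : ℝ := 2 * s * 4 ^ (-|2 * s - 1|) with hc
  set c' : ℝ := 2 * s * 4 ^ (|2 * s - 1|) with hc'
  have hcpos : 0 < c := by positivity
  have hcpos' : 0 < c' := by positivity
  refine ⟨c / 2, 2 * c', by positivity, by positivity, fun N => ?_⟩
  let K : Set (Ed d × ℝ) :=
    {p | ‖p‖ = 1} ∩ ({p | ‖p.1‖ ≤ c / 2 * |p.2|} ∪ {p | 2 * c' * |p.2| ≤ ‖p.1‖})
  have hKc : IsCompact K := by
    refine (isCompact_sphere (0 : Ed d × ℝ) 1).of_isClosed_subset ?_ ?_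
    · refine (isClosed_eq continuous_norm continuous_const).inter (IsClosed.union ?_ ?_)
      · exact isClosed_le (by fun_prop) (by fun_prop)
      · exact isClosed_le (by fun_prop) (by fun_prop)
    · intro p hp
      simpa using hp.1
  let S : Set ((Ed d × ℝ) × Ed d) := {z | z.2 ∈ unitAnnulus d}
  let ψ : (Ed d × ℝ) × Ed d → ℝ := fun z => ⟪z.1.1, z.2⟫ - z.1.2 * (‖z.2‖ ^ 2) ^ s
  have hψs : ∀ z ∈ S, ContDiffAt ℝ ∞ ψ z := fun z hz => by
    have h1 : ContDiffAt ℝ ∞ (fun z : (Ed d × ℝ) × Ed d => z.2) z := contDiffAt_snd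
    have h2 : ContDiffAt ℝ ∞ (fun z : (Ed d × ℝ) × Ed d => z.1.1) z :=
      contDiffAt_fst.comp z contDiffAt_fst
    have h3 : ContDiffAt ℝ ∞ (fun z : (Ed d × ℝ) × Ed d => z.1.2) z :=
      contDiffAt_snd.comp z contDiffAt_fst
    exact (h2.inner ℝ h1).sub
      (h3.mul (contDiffAt_norm_sq_rpow h1 (ne_zero_of_mem_unitAnnulus hz)))
  have hψ : IsNonstationary K S (unitAnnulus d) ψ := by
    refine ⟨isClosed_unitAnnulus.preimage continuous_snd, isCompact_unitAnnulus,
      fun z hz _ => hz, fun z hz _ => hψs z hz, ?_⟩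
    rintro ⟨⟨y, τ⟩, ξ⟩ hz ⟨hn, hK⟩
    have hξ : ξ ≠ 0 := ne_zero_of_mem_unitAnnulus hz
    have hd : HasFDerivAt (fun ξ => ψ ((y, τ), ξ)) (innerSL ℝ y -
        τ • ((2 * s * (‖ξ‖ ^ 2) ^ (s - 1)) • innerSL ℝ ξ)) ξ :=
      ((innerSL ℝ y).hasFDerivAt).sub ((hasFDerivAt_norm_sq_rpow s hξ).const_mul τ)
    by_contra hcon
    push Not at hcon
    have hv : ∀ v, ⟪y - (τ * (2 * s)) • ((‖ξ‖ ^ 2) ^ (s - 1)) • ξ, v⟫ = 0 := fun v => by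
      have := hcon v
      rw [fderiv_snd_apply ((hψs _ hz).differentiableAt (by simp)) hd] at this
      simp at this
      rw [inner_sub_left, real_inner_smul_left, real_inner_smul_left]
      linarith
    have h0 := inner_self_eq_zero.1 (hv _)
    have hny : ‖y‖ = |τ| * (2 * s * ‖ξ‖ ^ (2 * s - 1)) := by
      rw [sub_eq_zero.1 h0, norm_smul, norm_rpow_smul s hξ, norm_mul, Real.norm_eq_abs,
        Real.norm_of_nonneg (by positivity : 0 ≤ 2 * s)]
      ring
    obtain ⟨hlow, hupp⟩ := rpow_mem_of_mem_Icc hz.1 hz.2 (2 * s - 1)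
    have hlow' : c * |τ| ≤ ‖y‖ := by
      rw [hny, mul_comm, hc]
      gcongr
    have hupp' : ‖y‖ ≤ c' * |τ| := by
      rw [hny, mul_comm, hc']
      gcongr
    have hτ : 0 < |τ| := by
      rcases (abs_nonneg τ).eq_or_lt with h | h
      · have hy : ‖y‖ = 0 := by rw [hny, ← h, zero_mul]
        have : ‖((y, τ) : Ed d × ℝ)‖ = 0 := by simp [Prod.norm_def, hy, ← h]
        rw [Set.mem_ofPred_eq, this] at hn
        norm_num at hn
      · exact h
    rcases hK with hK | hK
    · have : ‖y‖ ≤ c / 2 * |τ| := hK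
      nlinarith [mul_pos hcpos hτ]
    · have : 2 * c' * |τ| ≤ ‖y‖ := hK
      nlinarith [mul_pos hcpos' hτ]
  have hA : IsAmplitude K S fun z => a z.2 :=
    ⟨fun z _ => (ha.comp contDiff_snd).contDiffAt, fun z hz => ha0 _ hz⟩
  obtain ⟨C, hC, h⟩ := hA.norm_integral_le hKc hψ N
  refine ⟨C, hC, fun x t ht hxt => ?_⟩
  set l : ℝ := ‖((x, t) : Ed d × ℝ)‖ with hl
  have hlt : |t| ≤ l := by
    rw [hl, Prod.norm_def]
    exact le_max_right _ _
  have ht' : 0 < |t| := abs_pos.2 ht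
  have hl0 : 0 < l := ht'.trans_le hlt
  have hp : (l⁻¹ • x, l⁻¹ * t) ∈ K := by
    constructor
    · change ‖l⁻¹ • ((x, t) : Ed d × ℝ)‖ = 1
      rw [norm_smul, Real.norm_of_nonneg (by positivity), ← hl, inv_mul_cancel₀ hl0.ne']
    · simp only [Set.mem_union, Set.mem_ofPred_eq, norm_smul, abs_mul, norm_inv, Real.norm_eq_abs,
        abs_inv, abs_of_pos hl0]
      refine hxt.imp (fun h => ?_) fun h => ?_
      · rw [mul_left_comm]
        gcongr
      · rw [mul_left_comm]
        gcongr
  have hb := h _ hp l hl0.ne'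
  have heq : oscInt s a x t =
      ∫ ξ, cexp (I * (l * ψ ((l⁻¹ • x, l⁻¹ * t), ξ) : ℝ)) * a ξ := by
    unfold oscInt
    congr 1 with ξ
    congr 4
    simp only [ψ, real_inner_smul_left, norm_rpow_two_mul]
    field_simp
  rw [heq]
  refine hb.trans ?_
  rw [abs_of_pos hl0]
  gcongr

/-- The divided difference of the phase `|ξ|^{2s}` in direction `ν` with step `ρ`, the point being
`((ρ, ν), ξ)`. -/
def phaseSlope (s : ℝ) (z : (ℝ × Ed d) × Ed d) : ℝ :=
  (2 * ⟪z.2, z.1.2⟫ + z.1.1 * ‖z.1.2‖ ^ 2) * (‖z.2‖ ^ 2) ^ (s - 1) *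
    dslope (fun u : ℝ => u ^ s) 1 (‖z.2 + z.1.1 • z.1.2‖ ^ 2 / ‖z.2‖ ^ 2)

lemma contDiffAt_dslope_rpow (s : ℝ) {u : ℝ} (hu : 0 < u) :
    ContDiffAt ℝ ∞ (dslope (fun u : ℝ => u ^ s) 1) u := by
  by_cases h1 : u = 1
  · subst h1
    have han : AnalyticAt ℝ (fun u : ℝ => u ^ s) 1 :=
      (Real.contDiffAt_rpow_const_of_ne one_ne_zero).analyticAt
    obtain ⟨p, hp⟩ := han
    exact (hp.has_fpower_series_dslope_fslope).analyticAt.contDiffAt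
  · have : ContDiffAt ℝ ∞ (slope (fun u : ℝ => u ^ s) 1) u := by
      simp only [slope_fun_def_field]
      exact ((Real.contDiffAt_rpow_const_of_ne hu.ne').sub contDiffAt_const).div
        (contDiffAt_id.sub contDiffAt_const) (sub_ne_zero.2 h1)
    exact this.congr_of_eventuallyEq (dslope_eventuallyEq_slope_of_ne _ h1)

lemma contDiffAt_phaseSlope (s : ℝ) {z : (ℝ × Ed d) × Ed d} (h : z.2 ≠ 0)
    (h' : z.2 + z.1.1 • z.1.2 ≠ 0) : ContDiffAt ℝ ∞ (phaseSlope s) z := by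
  have h1 : ContDiffAt ℝ ∞ (fun z : (ℝ × Ed d) × Ed d => z.2) z := contDiffAt_snd
  have h2 : ContDiffAt ℝ ∞ (fun z : (ℝ × Ed d) × Ed d => z.1.1) z :=
    contDiffAt_fst.comp z contDiffAt_fst
  have h3 : ContDiffAt ℝ ∞ (fun z : (ℝ × Ed d) × Ed d => z.1.2) z :=
    contDiffAt_snd.comp z contDiffAt_fst
  have hpos : 0 < ‖z.2‖ := norm_pos_iff.2 h
  have hpos' : 0 < ‖z.2 + z.1.1 • z.1.2‖ := norm_pos_iff.2 h'
  refine (((contDiffAt_const.mul (h1.inner ℝ h3)).add (h2.mul (h3.norm_sq ℝ))).mul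
    (contDiffAt_norm_sq_rpow h1 h)).mul ?_
  exact (contDiffAt_dslope_rpow s (by positivity)).comp z
    (((h1.add (h2.smul h3)).norm_sq ℝ).div (h1.norm_sq ℝ) (by positivity))

lemma mul_phaseSlope (s ρ : ℝ) (ν : Ed d) {ξ : Ed d} (h : ξ ≠ 0) :
    ρ * phaseSlope s ((ρ, ν), ξ) = (‖ξ + ρ • ν‖ ^ 2) ^ s - (‖ξ‖ ^ 2) ^ s := by
  have hpos : 0 < ‖ξ‖ ^ 2 := by positivity
  have hds := sub_smul_dslope (fun u : ℝ => u ^ s) 1 (‖ξ + ρ • ν‖ ^ 2 / ‖ξ‖ ^ 2)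
  have hexp : ‖ξ + ρ • ν‖ ^ 2 = ‖ξ‖ ^ 2 + ρ * (2 * ⟪ξ, ν⟫ + ρ * ‖ν‖ ^ 2) := by
    rw [norm_add_sq_real, real_inner_smul_right, norm_smul, mul_pow, Real.norm_eq_abs, sq_abs]
    ring
  simp only [smul_eq_mul, Real.one_rpow] at hds
  rw [Real.div_rpow (by positivity) hpos.le] at hds
  simp only [phaseSlope]
  set q := dslope (fun u : ℝ => u ^ s) 1 (‖ξ + ρ • ν‖ ^ 2 / ‖ξ‖ ^ 2)
  have hs1 : (‖ξ‖ ^ 2) ^ (s - 1) = (‖ξ‖ ^ 2) ^ s / ‖ξ‖ ^ 2 := Real.rpow_sub_one hpos.ne' s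
  have hps : 0 < (‖ξ‖ ^ 2) ^ s := Real.rpow_pos_of_pos hpos s
  have e1 : (‖ξ + ρ • ν‖ ^ 2) ^ s - (‖ξ‖ ^ 2) ^ s =
      (‖ξ‖ ^ 2) ^ s * ((‖ξ + ρ • ν‖ ^ 2) ^ s / (‖ξ‖ ^ 2) ^ s - 1) := by
    field_simp
  have e2 : ρ * (2 * ⟪ξ, ν⟫ + ρ * ‖ν‖ ^ 2) = ‖ξ‖ ^ 2 * (‖ξ + ρ • ν‖ ^ 2 / ‖ξ‖ ^ 2 - 1) := by
    rw [mul_sub, mul_div_cancel₀ _ hpos.ne', hexp]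
    ring
  rw [e1, ← hds, hs1]
  calc _ = (ρ * (2 * ⟪ξ, ν⟫ + ρ * ‖ν‖ ^ 2)) * ((‖ξ‖ ^ 2) ^ s / ‖ξ‖ ^ 2) * q := by ring
    _ = _ := by
      rw [e2]
      field_simp

lemma phaseSlope_zero (s : ℝ) (ν : Ed d) {ξ : Ed d} (h : ξ ≠ 0) :
    phaseSlope s ((0, ν), ξ) = 2 * s * (⟪ν, ξ⟫ * (‖ξ‖ ^ 2) ^ (s - 1)) := by
  have hpos : 0 < ‖ξ‖ ^ 2 := by positivity
  simp only [phaseSlope, zero_smul, add_zero, zero_mul, div_self hpos.ne', dslope_same]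
  rw [Real.deriv_rpow_const, real_inner_comm]
  simp
  ring

lemma rpow_smul_injective {s : ℝ} (hs' : s ≠ 1 / 2) {ξ η : Ed d} (hξ : ξ ≠ 0) (hη : η ≠ 0)
    (h : ((‖ξ‖ ^ 2) ^ (s - 1)) • ξ = ((‖η‖ ^ 2) ^ (s - 1)) • η) : ξ = η := by
  have hn := congrArg norm h
  rw [norm_rpow_smul s hξ, norm_rpow_smul s hη,
    Real.rpow_left_inj (norm_nonneg _) (norm_nonneg _)
      (fun h => hs' (by linarith))] at hn
  have hpos : 0 < ‖η‖ ^ 2 := by positivity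
  rw [hn] at h
  exact smul_right_injective _ (Real.rpow_pos_of_pos hpos _).ne' h

lemma exists_fderiv_phaseSlope_ne_zero {s : ℝ} (hs : 0 < s) (hs' : s ≠ 1 / 2) {ρ : ℝ}
    {ν ξ : Ed d} (hν : ν ≠ 0) (h : ξ ≠ 0) (h' : ξ + ρ • ν ≠ 0) :
    ∃ v : Ed d, fderiv ℝ (phaseSlope s) ((ρ, ν), ξ) (0, v) ≠ 0 := by
  have hdiff : DifferentiableAt ℝ (phaseSlope s) ((ρ, ν), ξ) :=
    (contDiffAt_phaseSlope s (z := ((ρ, ν), ξ)) h h').differentiableAt (by simp)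
  have hnhds : ∀ᶠ η in 𝓝 ξ, η ≠ 0 := isOpen_ne.mem_nhds h
  by_contra! hcon
  have hpos : 0 < ‖ξ‖ ^ 2 := by positivity
  by_cases hρ : ρ = 0
  · subst hρ
    have hd : HasFDerivAt (fun ξ => 2 * s * (⟪ν, ξ⟫ * (‖ξ‖ ^ 2) ^ (s - 1))) _ ξ :=
      (((innerSL ℝ ν).hasFDerivAt).mul (hasFDerivAt_norm_sq_rpow (s - 1) h)).const_mul (2 * s)
    have hd' := hd.congr_of_eventuallyEq (f₁ := fun ξ => phaseSlope s ((0, ν), ξ))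
      (hnhds.mono fun η hη => phaseSlope_zero s ν hη)
    have hv : ∀ v, ⟪ν, v⟫ * (‖ξ‖ ^ 2) ^ (s - 1) +
        ⟪ν, ξ⟫ * (2 * (s - 1) * (‖ξ‖ ^ 2) ^ (s - 1 - 1) * ⟪ξ, v⟫) = 0 := fun v => by
      have := hcon v
      rw [fderiv_snd_apply hdiff hd'] at this
      simp at this
      refine (mul_eq_zero_iff_left (a := 2 * s) (by positivity)).1 ?_
      linarith
    have hs1 : (‖ξ‖ ^ 2) ^ (s - 1 - 1) = (‖ξ‖ ^ 2) ^ (s - 1) / ‖ξ‖ ^ 2 :=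
      Real.rpow_sub_one hpos.ne' _
    have hps : 0 < (‖ξ‖ ^ 2) ^ (s - 1) := Real.rpow_pos_of_pos hpos _
    have hξ := hv ξ
    rw [hs1, real_inner_self_eq_norm_sq] at hξ
    have hξ' : (‖ξ‖ ^ 2) ^ (s - 1) * (2 * s - 1) * ⟪ν, ξ⟫ = 0 := by
      rw [← hξ]
      field_simp
      ring
    have hin : ⟪ν, ξ⟫ = 0 := by
      rcases mul_eq_zero.1 hξ' with h0 | h0
      · rcases mul_eq_zero.1 h0 with h0 | h0
        · exact absurd h0 hps.ne'
        · exact absurd (by linarith) hs'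
      · exact h0
    have hν' := hv ν
    rw [hin, zero_mul, add_zero, real_inner_self_eq_norm_sq] at hν'
    have : 0 < ‖ν‖ ^ 2 := by positivity
    exact (mul_pos this hps).ne' hν'
  · have hadd : HasFDerivAt (fun η : Ed d => η + ρ • ν) (ContinuousLinearMap.id ℝ (Ed d)) ξ :=
      (hasFDerivAt_id ξ).add_const _
    have hd1 : HasFDerivAt (fun ξ => (‖ξ + ρ • ν‖ ^ 2) ^ s) _ ξ :=
      HasFDerivAt.comp (g := fun η : Ed d => (‖η‖ ^ 2) ^ s) ξ (hasFDerivAt_norm_sq_rpow s h') hadd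
    have hd : HasFDerivAt (fun ξ => ρ⁻¹ * ((‖ξ + ρ • ν‖ ^ 2) ^ s - (‖ξ‖ ^ 2) ^ s)) _ ξ :=
      (hd1.sub (hasFDerivAt_norm_sq_rpow s h)).const_mul ρ⁻¹
    have hd' := hd.congr_of_eventuallyEq (f₁ := fun ξ => phaseSlope s ((ρ, ν), ξ))
      (hnhds.mono fun η hη => by
        beta_reduce
        rw [← mul_phaseSlope s ρ ν hη, inv_mul_cancel_left₀ hρ])
    have hv : ∀ v, ⟪((‖ξ + ρ • ν‖ ^ 2) ^ (s - 1)) • (ξ + ρ • ν) -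
        ((‖ξ‖ ^ 2) ^ (s - 1)) • ξ, v⟫ = 0 := fun v => by
      have := hcon v
      rw [fderiv_snd_apply hdiff hd'] at this
      simp only [smul_apply, sub_apply, ContinuousLinearMap.comp_apply,
        ContinuousLinearMap.id_apply, innerSL_apply_apply, smul_eq_mul] at this
      rw [inner_sub_left, real_inner_smul_left, real_inner_smul_left]
      have h2 := (mul_eq_zero.1 this).resolve_left (inv_ne_zero hρ)
      refine (mul_eq_zero_iff_left (a := 2 * s) (by positivity)).1 ?_
      linarith
    have h0 := rpow_smul_injective hs' h' h (sub_eq_zero.1 (inner_self_eq_zero.1 (hv _)))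
    have : ρ • ν = 0 := by simpa using h0
    exact (smul_ne_zero hρ hν) this

end OscillatoryIntegral

section StationaryPhase

open scoped ComplexConjugate

variable {d : ℕ} {s : ℝ} {a : Ed d → ℂ}

/-- The autocorrelation at shift `h` of the integrand of the oscillatory integral, up to a
unimodular factor. -/
def phaseCorr (s : ℝ) (a : Ed d → ℂ) (t : ℝ) (h : Ed d) : ℂ :=
  ∫ ξ, cexp (I * (t * (‖ξ + h‖ ^ (2 * s) - ‖ξ‖ ^ (2 * s)) : ℝ)) * (conj (a (ξ + h)) * a ξ)

lemma exists_phaseCorr_le_div (hs : 0 < s) (hs' : s ≠ 1 / 2) (ha : ContDiff ℝ ∞ a)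
    (ha0 : ∀ ξ ∉ unitAnnulus d, a ξ = 0) (N : ℕ) :
    ∃ C : ℝ, 0 ≤ C ∧ ∀ t h, t ≠ 0 → h ≠ 0 → ‖phaseCorr s a t h‖ ≤ C / (|t| * ‖h‖) ^ N := by
  let K : Set (ℝ × Ed d) := Set.Icc 0 8 ×ˢ Metric.sphere 0 1
  have hK : IsCompact K := isCompact_Icc.prod (isCompact_sphere 0 1)
  let S : Set ((ℝ × Ed d) × Ed d) :=
    {z | z.2 ∈ unitAnnulus d ∧ z.2 + z.1.1 • z.1.2 ∈ unitAnnulus d}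
  have hS : IsClosed S := (isClosed_unitAnnulus.preimage continuous_snd).inter
    (isClosed_unitAnnulus.preimage (by fun_prop))
  have hψ : IsNonstationary K S (unitAnnulus d) (phaseSlope s) := by
    refine ⟨hS, isCompact_unitAnnulus, fun z hz _ => hz.1, fun z hz _ =>
      contDiffAt_phaseSlope s (ne_zero_of_mem_unitAnnulus hz.1)
        (ne_zero_of_mem_unitAnnulus hz.2), fun z hz hzK => ?_⟩
    refine exists_fderiv_phaseSlope_ne_zero hs hs' ?_ (ne_zero_of_mem_unitAnnulus hz.1)
      (ne_zero_of_mem_unitAnnulus hz.2)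
    have h1 : ‖z.1.2‖ = 1 := by simpa using hzK.2
    exact norm_ne_zero_iff.1 (by rw [h1]; exact one_ne_zero)
  have hA : IsAmplitude K S fun z => conj (a (z.2 + z.1.1 • z.1.2)) * a z.2 := by
    refine ⟨fun z _ => ?_, fun z hz => ?_⟩
    · have h1 : ContDiff ℝ ∞ fun z : (ℝ × Ed d) × Ed d => z.2 + z.1.1 • z.1.2 := by fun_prop
      exact ((conjCLE.contDiff.comp (ha.comp h1)).mul (ha.comp contDiff_snd)).contDiffAt
    · by_cases h : z.2 ∈ unitAnnulus d
      · rw [ha0 (z.2 + z.1.1 • z.1.2) fun h' => hz ⟨h, h'⟩, map_zero, zero_mul]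
      · rw [ha0 _ h, mul_zero]
  obtain ⟨C, hC, hb⟩ := hA.norm_integral_le hK hψ N
  refine ⟨C, hC, fun t h ht hh => ?_⟩
  have hh' : 0 < ‖h‖ := norm_pos_iff.2 hh
  have hsm : ‖h‖ • (‖h‖⁻¹ • h) = h := smul_inv_smul₀ hh'.ne' h
  by_cases h8 : ‖h‖ ≤ 8
  · have hp : (‖h‖, ‖h‖⁻¹ • h) ∈ K :=
      ⟨⟨hh'.le, h8⟩, by simp [norm_smul, inv_mul_cancel₀ hh'.ne']⟩
    have := hb _ hp (t * ‖h‖) (mul_ne_zero ht hh'.ne')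
    rw [abs_mul, abs_norm] at this
    convert this using 2
    unfold phaseCorr
    congr 1 with ξ
    simp only [hsm]
    by_cases hξ : ξ ∈ unitAnnulus d
    · rw [mul_assoc t, mul_phaseSlope s _ _ (ne_zero_of_mem_unitAnnulus hξ), hsm,
        norm_rpow_two_mul, norm_rpow_two_mul]
    · rw [ha0 ξ hξ]
      simp
  · have : phaseCorr s a t h = 0 := by
      unfold phaseCorr
      rw [← integral_zero (Ed d) ℂ (μ := volume)]
      congr 1 with ξ
      by_cases hξ : ξ ∈ unitAnnulus d
      · rw [ha0 (ξ + h), map_zero, zero_mul, mul_zero]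
        intro h'
        have h1 := norm_sub_le (ξ + h) ξ
        rw [add_sub_cancel_left] at h1
        linarith [h'.2, hξ.2]
      · rw [ha0 ξ hξ, mul_zero, mul_zero]
    rw [this, norm_zero]
    positivity

lemma exists_phaseCorr_le (hs : 0 < s) (hs' : s ≠ 1 / 2) (ha : ContDiff ℝ ∞ a)
    (ha0 : ∀ ξ ∉ unitAnnulus d, a ξ = 0) (N : ℕ) :
    ∃ C : ℝ, 0 ≤ C ∧ ∀ t h, t ≠ 0 → h ≠ 0 →
      ‖phaseCorr s a t h‖ ≤ C * (1 + ‖t • h‖) ^ (-(N : ℝ)) := by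
  obtain ⟨C₀, hC₀, h₀⟩ := exists_phaseCorr_le_div hs hs' ha ha0 0
  obtain ⟨C₁, hC₁, h₁⟩ := exists_phaseCorr_le_div hs hs' ha ha0 N
  refine ⟨2 ^ (N - 1) * (C₀ + C₁), by positivity, fun t h ht hh => ?_⟩
  have h0 := h₀ t h ht hh
  have h1 := h₁ t h ht hh
  have hu : 0 < |t| * ‖h‖ := mul_pos (abs_pos.2 ht) (norm_pos_iff.2 hh)
  rw [pow_zero, div_one] at h0
  rw [le_div_iff₀ (by positivity)] at h1
  rw [norm_smul, Real.norm_eq_abs, Real.rpow_neg (by positivity), Real.rpow_natCast,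
    ← div_eq_mul_inv, le_div_iff₀ (by positivity)]
  calc ‖phaseCorr s a t h‖ * (1 + |t| * ‖h‖) ^ N
      ≤ ‖phaseCorr s a t h‖ * (2 ^ (N - 1) * (1 ^ N + (|t| * ‖h‖) ^ N)) := by
        gcongr
        exact add_pow_le zero_le_one hu.le N
    _ = 2 ^ (N - 1) * (‖phaseCorr s a t h‖ + ‖phaseCorr s a t h‖ * (|t| * ‖h‖) ^ N) := by
        rw [one_pow]
        ring
    _ ≤ _ := by gcongr

lemma hasCompactSupport_of_unitAnnulus (ha0 : ∀ ξ ∉ unitAnnulus d, a ξ = 0) :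
    HasCompactSupport a :=
  HasCompactSupport.intro isCompact_unitAnnulus ha0

lemma integrable_oscInt (hs : 0 < s) (ha : ContDiff ℝ ∞ a)
    (ha0 : ∀ ξ ∉ unitAnnulus d, a ξ = 0) (x : Ed d) (t : ℝ) :
    Integrable fun ξ => cexp (I * (⟪x, ξ⟫ - t * ‖ξ‖ ^ (2 * s) : ℝ)) * a ξ := by
  refine Continuous.integrable_of_hasCompactSupport ?_
    (hasCompactSupport_of_unitAnnulus ha0).mul_left
  have h1 : Continuous fun ξ : Ed d => ‖ξ‖ ^ (2 * s) :=
    continuous_norm.rpow_const fun _ => Or.inr (by positivity)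
  have h2 := ha.continuous
  fun_prop

lemma oscInt_mul_conj (hs : 0 < s) (ha : ContDiff ℝ ∞ a)
    (ha0 : ∀ ξ ∉ unitAnnulus d, a ξ = 0) (x : Ed d) (t : ℝ) :
    oscInt s a x t * conj (oscInt s a x t) =
      ∫ h, cexp (I * (-⟪x, h⟫ : ℝ)) * phaseCorr s a t h := by
  set f : Ed d → ℂ := fun ξ => cexp (I * (⟪x, ξ⟫ - t * ‖ξ‖ ^ (2 * s) : ℝ)) * a ξ with hf
  have hfi : Integrable f := integrable_oscInt hs ha ha0 x t
  have hfc : Integrable fun ξ => conj (f ξ) := conjCLE.toContinuousLinearMap.integrable_comp hfi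
  have hprod : Integrable (Function.uncurry fun ξ h => f ξ * conj (f (ξ + h)))
      ((volume : Measure (Ed d)).prod volume) :=
    (measurePreserving_prod_add (volume : Measure (Ed d)) (volume : Measure (Ed d)))
      |>.integrable_comp_of_integrable (hfi.mul_prod hfc)
  calc oscInt s a x t * conj (oscInt s a x t)
      = ∫ ξ, ∫ h, f ξ * conj (f (ξ + h)) := by
        change (∫ ξ, f ξ) * conj (∫ ξ, f ξ) = _
        rw [← integral_conj, ← integral_mul_const]
        congr 1 with ξ
        rw [integral_const_mul, integral_add_left_eq_self (fun η => conj (f η)) ξ]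
    _ = ∫ h, ∫ ξ, f ξ * conj (f (ξ + h)) := integral_integral_swap hprod
    _ = _ := by
        congr 1 with h
        unfold phaseCorr
        rw [← integral_const_mul]
        congr 1 with ξ
        simp only [hf, map_mul, ← exp_conj, conj_I, conj_ofReal]
        rw [mul_mul_mul_comm, ← exp_add, ← mul_assoc (cexp (I * (-⟪x, h⟫ : ℝ))), ← exp_add,
          mul_comm (a ξ)]
        congr 2
        rw [inner_add_right]
        push_cast
        ring

/-- Uniform decay `|t|^{-d/2}` of the oscillatory integral. -/
theorem exists_oscInt_le (hd : 0 < d) (hs : 0 < s) (hs' : s ≠ 1 / 2) (ha : ContDiff ℝ ∞ a)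
    (ha0 : ∀ ξ ∉ unitAnnulus d, a ξ = 0) :
    ∃ C : ℝ, 0 ≤ C ∧ ∀ x t, t ≠ 0 → ‖oscInt s a x t‖ ≤ C * |t| ^ (-((d : ℝ) / 2)) := by
  have : Nonempty (Fin d) := ⟨⟨0, hd⟩⟩
  obtain ⟨C, hC, hb⟩ := exists_phaseCorr_le hs hs' ha ha0 (d + 1)
  have hdecay : Integrable fun h : Ed d => (1 + ‖h‖) ^ (-((d + 1 : ℕ) : ℝ)) :=
    integrable_one_add_norm (by simp)
  set J : ℝ := ∫ h : Ed d, (1 + ‖h‖) ^ (-((d + 1 : ℕ) : ℝ)) with hJ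
  have hJ0 : 0 ≤ J := integral_nonneg fun h => by positivity
  refine ⟨√(C * J), Real.sqrt_nonneg _, fun x t ht => ?_⟩
  have ht' : 0 < |t| := abs_pos.2 ht
  have hsq : ‖oscInt s a x t‖ ^ 2 ≤ C * J * (|t| ^ (-((d : ℝ) / 2))) ^ 2 := by
    have h1 : ‖oscInt s a x t‖ ^ 2 = ‖oscInt s a x t * conj (oscInt s a x t)‖ := by
      rw [norm_mul, RCLike.norm_conj, sq]
    rw [h1, oscInt_mul_conj hs ha ha0]
    have hae : ∀ᵐ h : Ed d, ‖cexp (I * (-⟪x, h⟫ : ℝ)) * phaseCorr s a t h‖ ≤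
        C * (1 + ‖t • h‖) ^ (-((d + 1 : ℕ) : ℝ)) := by
      filter_upwards [compl_mem_ae_iff.2 (measure_singleton (0 : Ed d))] with h hh
      rw [norm_mul, mul_comm I, norm_exp_ofReal_mul_I, one_mul]
      exact hb t h ht hh
    refine (norm_integral_le_of_norm_le ((hdecay.comp_smul ht).const_mul C) hae).trans (le_of_eq ?_)
    rw [integral_const_mul, Measure.integral_comp_smul volume
      (fun h : Ed d => (1 + ‖h‖) ^ (-((d + 1 : ℕ) : ℝ))) t, ← hJ, smul_eq_mul, mul_assoc,
      finrank_euclideanSpace_fin, ← Real.rpow_natCast (|t| ^ _) 2, ← Real.rpow_mul ht'.le,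
      abs_inv, abs_pow, ← Real.rpow_natCast |t| d, ← Real.rpow_neg ht'.le, mul_comm J]
    congr 3
    push_cast
    ring
  calc ‖oscInt s a x t‖ = √(‖oscInt s a x t‖ ^ 2) := (Real.sqrt_sq (norm_nonneg _)).symm
    _ ≤ √(C * J * (|t| ^ (-((d : ℝ) / 2))) ^ 2) := Real.sqrt_le_sqrt hsq
    _ = _ := by rw [Real.sqrt_mul (by positivity), Real.sqrt_sq (by positivity)]

end StationaryPhase

section DyadicSum

variable {d : ℕ} {s : ℝ}

/-- The weight `v / (1 + v)²`, small at both ends of `(0, ∞)`. -/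
def bumpWeight (v : ℝ) : ℝ := v / (1 + v) ^ 2

lemma bumpWeight_nonneg {v : ℝ} (hv : 0 ≤ v) : 0 ≤ bumpWeight v := by
  unfold bumpWeight
  positivity

lemma bumpWeight_le {q v : ℝ} (hq : 0 < q) (hq1 : q ≠ 1) (hv : 0 ≤ v) :
    bumpWeight v ≤ (1 + q) / (q - 1) * (v * q / (1 + v * q) - v / (1 + v)) := by
  have h1 : q - 1 ≠ 0 := sub_ne_zero.2 hq1
  have h2 : 0 < 1 + v := by positivity
  have h3 : 0 < 1 + v * q := by positivity
  have e : (1 + q) / (q - 1) * (v * q / (1 + v * q) - v / (1 + v)) =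
      (1 + q) * v / ((1 + v) * (1 + v * q)) := by
    field_simp
    ring
  rw [e, bumpWeight, div_le_div_iff₀ (by positivity) (by positivity)]
  have : 0 ≤ v * (1 + v) * (v + q) := by positivity
  nlinarith

lemma sum_bumpWeight_le {q : ℝ} (hq : 0 < q) (hq1 : q ≠ 1) {ρ : ℝ} (hρ : 0 ≤ ρ) (M : ℕ) :
    ∑ n ∈ Finset.range M, bumpWeight (ρ * q ^ n) ≤ (1 + q) / |q - 1| := by
  have hg : ∀ v : ℝ, 0 ≤ v → 0 ≤ v / (1 + v) ∧ v / (1 + v) ≤ 1 := fun v hv =>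
    ⟨by positivity, (div_le_one (by positivity)).2 (by linarith)⟩
  calc ∑ n ∈ Finset.range M, bumpWeight (ρ * q ^ n)
      ≤ ∑ n ∈ Finset.range M, (1 + q) / (q - 1) *
          (ρ * q ^ (n + 1) / (1 + ρ * q ^ (n + 1)) - ρ * q ^ n / (1 + ρ * q ^ n)) := by
        refine Finset.sum_le_sum fun n _ => ?_
        have := bumpWeight_le hq hq1 (v := ρ * q ^ n) (by positivity)
        rwa [mul_assoc ρ, ← pow_succ] at this
    _ = (1 + q) / (q - 1) * (ρ * q ^ M / (1 + ρ * q ^ M) - ρ * q ^ 0 / (1 + ρ * q ^ 0)) := by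
        rw [← Finset.mul_sum, Finset.sum_range_sub (fun n => ρ * q ^ n / (1 + ρ * q ^ n))]
    _ ≤ |(1 + q) / (q - 1)| *
          |ρ * q ^ M / (1 + ρ * q ^ M) - ρ * q ^ 0 / (1 + ρ * q ^ 0)| := by
        rw [← abs_mul]
        exact le_abs_self _
    _ ≤ |(1 + q) / (q - 1)| * 1 := by
        obtain ⟨h1, h2⟩ := hg (ρ * q ^ M) (by positivity)
        obtain ⟨h3, h4⟩ := hg (ρ * q ^ 0) (by positivity)
        gcongr
        rw [abs_le]
        constructor <;> linarith
    _ = _ := by rw [mul_one, abs_div, abs_of_pos (by positivity : 0 < 1 + q)]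

/-- The oscillatory integral decays like `|t|^{-θ}`, with an additional gain unless `|x| ∼ |t|`
or `|t| ∼ 1`. -/
lemma exists_oscInt_le_weight (hd : 0 < d) (hs : 0 < s) (hs' : s ≠ 1 / 2) {a : Ed d → ℂ}
    (ha : ContDiff ℝ ∞ a) (ha0 : ∀ ξ ∉ unitAnnulus d, a ξ = 0) {θ : ℝ} (hθ : 0 < θ)
    (hθd : θ ≤ (d : ℝ) / 2) :
    ∃ C : ℝ, 0 ≤ C ∧ ∀ x t, t ≠ 0 → ‖oscInt s a x t‖ ≤
      C * |t| ^ (-θ) * (bumpWeight (‖x‖ / |t|) + bumpWeight (|t| ^ θ)) := by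
  obtain ⟨c₁, c₂, hc₁, hc₂, hnr⟩ := exists_oscInt_le_of_nonresonant hs ha ha0
  obtain ⟨N, hN⟩ := exists_nat_ge (2 * θ)
  obtain ⟨C₁, hC₁, h₁⟩ := hnr N
  obtain ⟨C₂, hC₂, h₂⟩ := exists_oscInt_le hd hs hs' ha ha0
  set C₀ : ℝ := ∫ ξ, ‖a ξ‖ with hC₀'
  have hC₀ : 0 ≤ C₀ := integral_nonneg fun ξ => norm_nonneg _
  have h₀ : ∀ x t, ‖oscInt s a x t‖ ≤ C₀ := fun x t => by
    refine (norm_integral_le_integral_norm _).trans (le_of_eq ?_)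
    congr 1 with ξ
    rw [norm_mul, mul_comm I, norm_exp_ofReal_mul_I, one_mul]
  set k : ℝ := c₁ / (1 + c₂) ^ 2 with hk
  have hk0 : 0 < k := by positivity
  refine ⟨4 * (C₀ + C₁) + (C₀ + C₂) / k, by positivity, fun x t ht => ?_⟩
  have ht' : 0 < |t| := abs_pos.2 ht
  have hw1 : 0 ≤ bumpWeight (‖x‖ / |t|) := bumpWeight_nonneg (by positivity)
  have hw2 : 0 ≤ bumpWeight (|t| ^ θ) := bumpWeight_nonneg (by positivity)
  have hT : 0 < |t| ^ θ := by positivity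
  by_cases hres : ‖x‖ ≤ c₁ * |t| ∨ c₂ * |t| ≤ ‖x‖
  · have e : |t| ^ (-θ) * bumpWeight (|t| ^ θ) = 1 / (1 + |t| ^ θ) ^ 2 := by
      rw [Real.rpow_neg ht'.le, bumpWeight]
      field_simp
    have key : ‖oscInt s a x t‖ ≤ 4 * (C₀ + C₁) * (|t| ^ (-θ) * bumpWeight (|t| ^ θ)) := by
      rw [e, mul_one_div, le_div_iff₀ (by positivity)]
      rcases le_total |t| 1 with h1 | h1
      · have hT1 : |t| ^ θ ≤ 1 := Real.rpow_le_one ht'.le h1 hθ.le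
        calc ‖oscInt s a x t‖ * (1 + |t| ^ θ) ^ 2 ≤ C₀ * (1 + 1) ^ 2 := by
              gcongr
              exact h₀ x t
          _ ≤ _ := by nlinarith
      · have hT1 : 1 ≤ |t| ^ θ := Real.one_le_rpow h1 hθ.le
        have hTN : (|t| ^ θ) ^ 2 ≤ |t| ^ N := by
          rw [← Real.rpow_natCast, ← Real.rpow_mul ht'.le, ← Real.rpow_natCast]
          refine Real.rpow_le_rpow_of_exponent_le h1 ?_
          push_cast
          linarith
        have hb := h₁ x t ht hres
        rw [le_div_iff₀ (by positivity)] at hb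
        calc ‖oscInt s a x t‖ * (1 + |t| ^ θ) ^ 2
            ≤ ‖oscInt s a x t‖ * (4 * |t| ^ N) := by
              gcongr
              nlinarith
          _ ≤ _ := by nlinarith
    refine key.trans ?_
    rw [mul_assoc (4 * (C₀ + C₁) + (C₀ + C₂) / k)]
    gcongr
    · have : 0 ≤ (C₀ + C₂) / k := by positivity
      linarith
    · linarith
  · push Not at hres
    have hu1 : c₁ ≤ ‖x‖ / |t| := (le_div_iff₀ ht').2 hres.1.le
    have hu2 : ‖x‖ / |t| ≤ c₂ := (div_le_iff₀ ht').2 hres.2.le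
    have hkw : k ≤ bumpWeight (‖x‖ / |t|) := by
      rw [hk, bumpWeight]
      gcongr
    have key : ‖oscInt s a x t‖ ≤ (C₀ + C₂) * |t| ^ (-θ) := by
      rcases le_total |t| 1 with h1 | h1
      · have : 1 ≤ |t| ^ (-θ) := Real.one_le_rpow_of_pos_of_le_one_of_nonpos ht' h1 (by linarith)
        nlinarith [h₀ x t]
      · have : |t| ^ (-((d : ℝ) / 2)) ≤ |t| ^ (-θ) :=
          Real.rpow_le_rpow_of_exponent_le h1 (by linarith)
        have h3 := mul_le_mul_of_nonneg_left this hC₂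
        have h4 : 0 ≤ C₀ * |t| ^ (-θ) := by positivity
        linarith [h₂ x t ht]
    calc ‖oscInt s a x t‖ ≤ (C₀ + C₂) * |t| ^ (-θ) := key
      _ = (C₀ + C₂) / k * |t| ^ (-θ) * k := by field_simp
      _ ≤ _ := by
        gcongr
        · linarith
        · linarith

/-- A smooth cutoff equal to `1` on the ball of radius `2` and supported in that of radius `4`. -/
def freqBump (d : ℕ) : ContDiffBump (0 : Ed d) := ⟨2, 4, by norm_num, by norm_num⟩

lemma freqBump_eq_one {ξ : Ed d} (h : ‖ξ‖ ≤ 2) : freqBump d ξ = 1 :=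
  (freqBump d).one_of_mem_closedBall (by simpa [freqBump] using h)

lemma freqBump_eq_zero {ξ : Ed d} (h : 4 ≤ ‖ξ‖) : freqBump d ξ = 0 :=
  (freqBump d).zero_of_le_dist (by simpa [freqBump] using h)

/-- The unit-scale dyadic piece of the multiplier `|ξ|^β`. -/
def dyadicAmp (d : ℕ) (β : ℝ) (ξ : Ed d) : ℂ :=
  ((‖ξ‖ ^ β * (freqBump d ξ - freqBump d ((2 : ℝ) • ξ)) : ℝ) : ℂ)

lemma norm_two_smul (ξ : Ed d) : ‖(2 : ℝ) • ξ‖ = 2 * ‖ξ‖ := by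
  rw [norm_smul]
  norm_num

lemma dyadicAmp_eq_zero_of_lt {β : ℝ} {ξ : Ed d} (h : ‖ξ‖ < 1) : dyadicAmp d β ξ = 0 := by
  rw [dyadicAmp, freqBump_eq_one (by linarith), freqBump_eq_one (by rw [norm_two_smul]; linarith)]
  simp

lemma dyadicAmp_eq_zero {β : ℝ} {ξ : Ed d} (h : ξ ∉ unitAnnulus d) : dyadicAmp d β ξ = 0 := by
  rcases lt_or_ge ‖ξ‖ 1 with h1 | h1
  · exact dyadicAmp_eq_zero_of_lt h1
  · have h4 : 4 ≤ ‖ξ‖ := by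
      by_contra hc
      exact h ⟨h1, by linarith⟩
    rw [dyadicAmp, freqBump_eq_zero h4, freqBump_eq_zero (by rw [norm_two_smul]; linarith)]
    simp

lemma contDiff_dyadicAmp (d : ℕ) (β : ℝ) : ContDiff ℝ ∞ (dyadicAmp d β) := by
  refine contDiff_iff_contDiffAt.2 fun ξ => ?_
  by_cases h : ξ = 0
  · refine (contDiffAt_const (c := (0 : ℂ))).congr_of_eventuallyEq ?_
    filter_upwards [Metric.ball_mem_nhds ξ one_pos] with η hη
    exact dyadicAmp_eq_zero_of_lt (by simpa [h] using hη)
  · refine ofRealCLM.contDiff.contDiffAt.comp ξ ?_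
    refine ((contDiffAt_norm ℝ h).rpow_const_of_ne (norm_ne_zero_iff.2 h)).mul ?_
    exact ((freqBump d).contDiff.sub
      ((freqBump d).contDiff.comp (contDiff_const_smul (2 : ℝ)))).contDiffAt

/-- The frequency-truncated multiplier `|ξ|^β (η(ξ) - η(2^M ξ))`. -/
def truncAmp (d : ℕ) (β : ℝ) (M : ℕ) (ξ : Ed d) : ℂ :=
  ((‖ξ‖ ^ β * (freqBump d ξ - freqBump d ((2 : ℝ) ^ M • ξ)) : ℝ) : ℂ)

lemma truncAmp_eq_sum (β : ℝ) (M : ℕ) (ξ : Ed d) :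
    truncAmp d β M ξ = ∑ n ∈ Finset.range M,
      (((2 : ℝ) ^ n) ^ (-β) : ℝ) * dyadicAmp d β ((2 : ℝ) ^ n • ξ) := by
  have h : ∀ n : ℕ, ((((2 : ℝ) ^ n) ^ (-β) : ℝ) : ℂ) * dyadicAmp d β ((2 : ℝ) ^ n • ξ) =
      ((‖ξ‖ ^ β * (freqBump d ((2 : ℝ) ^ n • ξ) - freqBump d ((2 : ℝ) ^ (n + 1) • ξ)) : ℝ) : ℂ) := by
    intro n
    have h2 : (0 : ℝ) < 2 ^ n := by positivity
    rw [dyadicAmp, ← ofReal_mul, norm_smul, Real.norm_of_nonneg h2.le,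
      Real.mul_rpow h2.le (norm_nonneg _), smul_smul, ← pow_succ', ← mul_assoc, ← mul_assoc,
      Real.rpow_neg h2.le, inv_mul_cancel₀ (by positivity), one_mul]
  simp_rw [h]
  rw [← ofReal_sum, ← Finset.mul_sum,
    Finset.sum_range_sub' (fun n => freqBump d ((2 : ℝ) ^ n • ξ)), truncAmp]
  simp

lemma integral_dyadicAmp_smul (s β : ℝ) {R : ℝ} (hR : 0 < R) (x : Ed d) (t : ℝ) :
    ∫ ξ, cexp (I * (⟪x, ξ⟫ - t * ‖ξ‖ ^ (2 * s) : ℝ)) * dyadicAmp d β (R • ξ) =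
      (R ^ (-(d : ℝ)) : ℝ) * oscInt s (dyadicAmp d β) (R⁻¹ • x) (R ^ (-(2 * s)) * t) := by
  have h := Measure.integral_comp_smul (volume : Measure (Ed d))
    (fun ζ => cexp (I * (⟪R⁻¹ • x, ζ⟫ - R ^ (-(2 * s)) * t * ‖ζ‖ ^ (2 * s) : ℝ)) *
      dyadicAmp d β ζ) R
  rw [finrank_euclideanSpace_fin, abs_of_pos (by positivity), ← Real.rpow_natCast,
    ← Real.rpow_neg hR.le, real_smul] at h
  rw [oscInt, ← h]
  congr 1 with ξ
  congr 4
  rw [real_inner_smul_left, real_inner_smul_right, inv_mul_cancel_left₀ hR.ne', norm_smul,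
    Real.norm_of_nonneg hR.le, Real.mul_rpow hR.le (norm_nonneg _), Real.rpow_neg hR.le]
  have : 0 < R ^ (2 * s) := by positivity
  field_simp

lemma oscInt_truncAmp (hs : 0 < s) (β : ℝ) (M : ℕ) (x : Ed d) (t : ℝ) :
    oscInt s (truncAmp d β M) x t = ∑ n ∈ Finset.range M,
      (((2 : ℝ) ^ n) ^ (-(d + β)) : ℝ) * oscInt s (dyadicAmp d β) (((2 : ℝ) ^ n)⁻¹ • x)
        (((2 : ℝ) ^ n) ^ (-(2 * s)) * t) := by
  unfold oscInt
  simp_rw [truncAmp_eq_sum, Finset.mul_sum]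
  rw [integral_finsetSum]
  · refine Finset.sum_congr rfl fun n _ => ?_
    simp_rw [mul_left_comm (cexp _)]
    have h2 : (0 : ℝ) < 2 ^ n := by positivity
    rw [integral_const_mul, integral_dyadicAmp_smul s β h2, ← mul_assoc, ← ofReal_mul,
      ← Real.rpow_add h2, neg_add_rev]
    rfl
  · intro n _
    have h2 : (2 : ℝ) ^ n ≠ 0 := by positivity
    refine Continuous.integrable_of_hasCompactSupport ?_ ?_
    · have h1 : Continuous fun ξ : Ed d => ‖ξ‖ ^ (2 * s) :=
        continuous_norm.rpow_const fun _ => Or.inr (by positivity)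
      have h3 := (contDiff_dyadicAmp d β).continuous
      fun_prop
    · refine HasCompactSupport.mul_left (HasCompactSupport.mul_left ?_)
      exact (hasCompactSupport_of_unitAnnulus fun ξ hξ => dyadicAmp_eq_zero hξ).comp_smul h2

end DyadicSum

section KernelBound

variable {d : ℕ} {s β θ : ℝ}

lemma integrableOn_norm_rpow (hd : 0 < d) (hβ : -(d : ℝ) < β) (r : ℝ) :
    IntegrableOn (fun ξ : Ed d => ‖ξ‖ ^ β) (Metric.closedBall 0 r) := by
  have h : LocallyIntegrable (fun ξ : Ed d => ‖ξ‖ ^ β) volume := by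
    refine locallyIntegrable_of_norm_le_rpow (α := -β) (C := 1) ?_ ?_ ?_ ?_
    · rw [finrank_euclideanSpace_fin]; exact hd
    · rw [finrank_euclideanSpace_fin]; linarith
    · refine Filter.Eventually.of_forall fun ξ => ?_
      rw [neg_neg, one_mul, Real.norm_of_nonneg (by positivity)]
    · exact (measurable_norm.pow_const β).aestronglyMeasurable
  exact h.integrableOn_isCompact (isCompact_closedBall 0 r)

lemma norm_truncAmp_le (β : ℝ) (M : ℕ) (ξ : Ed d) :
    ‖truncAmp d β M ξ‖ ≤ (Metric.closedBall (0 : Ed d) 4).indicator (fun ξ => ‖ξ‖ ^ β) ξ := by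
  by_cases h : ξ ∈ Metric.closedBall (0 : Ed d) 4
  · rw [Set.indicator_of_mem h, truncAmp, norm_real, norm_mul,
      Real.norm_of_nonneg (by positivity : 0 ≤ ‖ξ‖ ^ β)]
    refine mul_le_of_le_one_right (by positivity) ?_
    rw [Real.norm_eq_abs, abs_le]
    have h1 := (freqBump d).nonneg (x := ξ)
    have h2 := (freqBump d).le_one (x := ξ)
    have h3 := (freqBump d).nonneg (x := (2 : ℝ) ^ M • ξ)
    have h4 := (freqBump d).le_one (x := (2 : ℝ) ^ M • ξ)
    constructor <;> linarith
  · rw [Set.indicator_of_notMem h]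
    have h4 : 4 ≤ ‖ξ‖ := by
      rw [mem_closedBall_zero_iff, not_le] at h
      exact h.le
    have h5 : 4 ≤ ‖(2 : ℝ) ^ M • ξ‖ := by
      rw [norm_smul, norm_pow, Real.norm_two]
      have : (1 : ℝ) ≤ 2 ^ M := one_le_pow₀ (by norm_num)
      nlinarith
    rw [truncAmp, freqBump_eq_zero h4, freqBump_eq_zero h5]
    simp

lemma measurable_truncAmp (β : ℝ) (M : ℕ) : Measurable (truncAmp d β M) := by
  have h1 : Measurable fun ξ : Ed d => freqBump d ξ := (freqBump d).continuous.measurable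
  have h2 : Measurable fun ξ : Ed d => freqBump d ((2 : ℝ) ^ M • ξ) :=
    h1.comp (measurable_const_smul _)
  exact measurable_ofReal.comp ((measurable_norm.pow_const β).mul (h1.sub h2))

lemma integrable_indicator_norm_rpow (hd : 0 < d) (hβ : -(d : ℝ) < β) :
    Integrable ((Metric.closedBall (0 : Ed d) 4).indicator fun ξ => ‖ξ‖ ^ β) :=
  (integrableOn_norm_rpow hd hβ 4).integrable_indicator Metric.isClosed_closedBall.measurableSet

lemma integrable_truncAmp (hd : 0 < d) (hβ : -(d : ℝ) < β) (M : ℕ) :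
    Integrable (truncAmp d β M) :=
  (integrable_indicator_norm_rpow hd hβ).mono'
    (measurable_truncAmp β M).aestronglyMeasurable
    (Filter.Eventually.of_forall (norm_truncAmp_le β M))

lemma norm_cexp_I_mul_ofReal (r : ℝ) : ‖cexp (I * (r : ℂ))‖ = 1 := by
  rw [mul_comm, norm_exp_ofReal_mul_I]

lemma norm_oscInt_truncAmp_le (hd : 0 < d) (hβ : -(d : ℝ) < β) (M : ℕ) (x : Ed d) (t : ℝ) :
    ‖oscInt s (truncAmp d β M) x t‖ ≤
      ∫ ξ, (Metric.closedBall (0 : Ed d) 4).indicator (fun ξ => ‖ξ‖ ^ β) ξ := by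
  refine norm_integral_le_of_norm_le (integrable_indicator_norm_rpow hd hβ)
    (Filter.Eventually.of_forall fun ξ => ?_)
  rw [norm_mul, norm_cexp_I_mul_ofReal, one_mul]
  exact norm_truncAmp_le β M ξ

/-- The truncated convolution kernels decay like `|t|^{-θ}`, uniformly in the truncation. -/
lemma exists_oscInt_truncAmp_le (hd : 0 < d) (hs : 0 < s) (hs' : s ≠ 1 / 2)
    (hβ : -(d : ℝ) < β) (hθ0 : 0 ≤ θ) (hθd : θ ≤ (d : ℝ) / 2) (hθβ : 2 * s * θ ≤ d + β) :
    ∃ C, 0 ≤ C ∧ ∀ (M : ℕ) (x : Ed d) (t : ℝ), t ≠ 0 →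
      ‖oscInt s (truncAmp d β M) x t‖ ≤ C * |t| ^ (-θ) := by
  rcases hθ0.eq_or_lt with rfl | hθ
  · refine ⟨∫ ξ, (Metric.closedBall (0 : Ed d) 4).indicator (fun ξ => ‖ξ‖ ^ β) ξ,
      integral_nonneg fun ξ => Set.indicator_nonneg (fun _ _ => by positivity) ξ,
      fun M x t _ => ?_⟩
    rw [neg_zero, Real.rpow_zero, mul_one]
    exact norm_oscInt_truncAmp_le hd hβ M x t
  obtain ⟨C, hC, hb⟩ := exists_oscInt_le_weight hd hs hs' (contDiff_dyadicAmp d β)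
    (fun ξ hξ => dyadicAmp_eq_zero hξ) hθ hθd
  set q : ℝ := 2 ^ (2 * s - 1) with hq
  set p : ℝ := 2 ^ (-(2 * s * θ)) with hp
  have hq0 : 0 < q := by positivity
  have hp0 : 0 < p := by positivity
  have hq1 : q ≠ 1 := by
    intro h
    have h' := (Real.rpow_right_inj (by norm_num : (0 : ℝ) < 2) (by norm_num)).mp
      (h.trans (Real.rpow_zero 2).symm)
    exact hs' (by linarith)
  have hp1 : p ≠ 1 := by
    intro h
    have h' := (Real.rpow_right_inj (by norm_num : (0 : ℝ) < 2) (by norm_num)).mp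
      (h.trans (Real.rpow_zero 2).symm)
    have : 0 < 2 * s * θ := by positivity
    linarith
  refine ⟨C * ((1 + q) / |q - 1| + (1 + p) / |p - 1|), by positivity, fun M x t ht => ?_⟩
  have ht0 : 0 < |t| := abs_pos.mpr ht
  have hterm : ∀ n : ℕ,
      ‖((((2 : ℝ) ^ n) ^ (-(d + β)) : ℝ) : ℂ) * oscInt s (dyadicAmp d β) (((2 : ℝ) ^ n)⁻¹ • x)
        (((2 : ℝ) ^ n) ^ (-(2 * s)) * t)‖ ≤
      C * |t| ^ (-θ) * (bumpWeight (‖x‖ / |t| * q ^ n) + bumpWeight (|t| ^ θ * p ^ n)) := by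
    intro n
    set R : ℝ := 2 ^ n with hR
    have hR0 : 0 < R := by positivity
    have hR1 : 1 ≤ R := one_le_pow₀ (by norm_num)
    have hpow : ∀ a : ℝ, ((2 : ℝ) ^ a) ^ n = R ^ a := by
      intro a
      rw [hR, ← Real.rpow_natCast, ← Real.rpow_natCast, ← Real.rpow_mul (by norm_num),
        ← Real.rpow_mul (by norm_num), mul_comm]
    have htR : |R ^ (-(2 * s)) * t| = R ^ (-(2 * s)) * |t| := by
      rw [abs_mul, abs_of_pos (by positivity)]
    have h := hb (R⁻¹ • x) (R ^ (-(2 * s)) * t) (by positivity)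
    have e1 : ‖R⁻¹ • x‖ / |R ^ (-(2 * s)) * t| = ‖x‖ / |t| * q ^ n := by
      rw [htR, norm_smul, norm_inv, Real.norm_of_nonneg hR0.le, hq, hpow, Real.rpow_sub hR0,
        Real.rpow_neg hR0.le, Real.rpow_one]
      have : 0 < R ^ (2 * s) := by positivity
      field_simp
    have e2 : |R ^ (-(2 * s)) * t| ^ θ = |t| ^ θ * p ^ n := by
      rw [htR, Real.mul_rpow (by positivity) ht0.le, ← Real.rpow_mul hR0.le, hp, hpow, mul_comm,
        neg_mul]
    have e3 : |R ^ (-(2 * s)) * t| ^ (-θ) = R ^ (2 * s * θ) * |t| ^ (-θ) := by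
      rw [htR, Real.mul_rpow (by positivity) ht0.le, ← Real.rpow_mul hR0.le, neg_mul_neg]
    rw [e1, e2, e3] at h
    rw [norm_mul, norm_real, Real.norm_of_nonneg (by positivity)]
    have hle : R ^ (-(d + β)) * R ^ (2 * s * θ) ≤ 1 := by
      rw [← Real.rpow_add hR0]
      exact Real.rpow_le_one_of_one_le_of_nonpos hR1 (by linarith)
    have hw : 0 ≤ C * |t| ^ (-θ) *
        (bumpWeight (‖x‖ / |t| * q ^ n) + bumpWeight (|t| ^ θ * p ^ n)) := by
      have h1 : 0 ≤ bumpWeight (‖x‖ / |t| * q ^ n) := bumpWeight_nonneg (by positivity)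
      have h2 : 0 ≤ bumpWeight (|t| ^ θ * p ^ n) := bumpWeight_nonneg (by positivity)
      positivity
    calc _ ≤ R ^ (-(d + β)) * (C * (R ^ (2 * s * θ) * |t| ^ (-θ)) *
          (bumpWeight (‖x‖ / |t| * q ^ n) + bumpWeight (|t| ^ θ * p ^ n))) := by gcongr
      _ = R ^ (-(d + β)) * R ^ (2 * s * θ) * (C * |t| ^ (-θ) *
          (bumpWeight (‖x‖ / |t| * q ^ n) + bumpWeight (|t| ^ θ * p ^ n))) := by ring
      _ ≤ _ := mul_le_of_le_one_left hw hle
  rw [oscInt_truncAmp hs]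
  calc _ ≤ ∑ n ∈ Finset.range M, C * |t| ^ (-θ) *
        (bumpWeight (‖x‖ / |t| * q ^ n) + bumpWeight (|t| ^ θ * p ^ n)) :=
        norm_sum_le_of_le _ fun n _ => hterm n
    _ = C * |t| ^ (-θ) * (∑ n ∈ Finset.range M, bumpWeight (‖x‖ / |t| * q ^ n) +
        ∑ n ∈ Finset.range M, bumpWeight (|t| ^ θ * p ^ n)) := by
        rw [← Finset.mul_sum, Finset.sum_add_distrib]
    _ ≤ C * |t| ^ (-θ) * ((1 + q) / |q - 1| + (1 + p) / |p - 1|) := by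
        gcongr
        · exact sum_bumpWeight_le hq0 hq1 (by positivity) M
        · exact sum_bumpWeight_le hp0 hp1 (by positivity) M
    _ = _ := by ring

end KernelBound

section Propagator

variable {d : ℕ} {s β : ℝ}

lemma norm_FT_le (u : Ed d → ℂ) (ξ : Ed d) : ‖FT u ξ‖ ≤ ∫ y, ‖u y‖ := by
  refine (norm_integral_le_integral_norm _).trans_eq ?_
  congr 1 with y
  rw [norm_mul, neg_mul, ← mul_neg, ← ofReal_neg, norm_cexp_I_mul_ofReal, one_mul]

lemma integrable_cexp_mul_truncAmp_mul (hd : 0 < d) (hs : 0 < s) (hβ : -(d : ℝ) < β) (M : ℕ)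
    {u : Ed d → ℂ} (hu : Integrable u) (x : Ed d) (t : ℝ) :
    Integrable (fun z : Ed d × Ed d => cexp (I * (⟪x - z.2, z.1⟫ - t * ‖z.1‖ ^ (2 * s) : ℝ)) *
      (truncAmp d β M z.1 * u z.2)) (volume.prod volume) := by
  refine ((integrable_truncAmp hd hβ M).mul_prod hu).bdd_mul (c := 1) ?_ ?_
  · have h1 : Continuous fun z : Ed d × Ed d => ‖z.1‖ ^ (2 * s) :=
      continuous_fst.norm.rpow_const fun _ => Or.inr (by positivity)
    have h2 : Continuous fun z : Ed d × Ed d =>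
      cexp (I * (⟪x - z.2, z.1⟫ - t * ‖z.1‖ ^ (2 * s) : ℝ)) := by fun_prop
    exact h2.aestronglyMeasurable
  · exact Filter.Eventually.of_forall fun z => (norm_cexp_I_mul_ofReal _).le

lemma integral_truncAmp_mul_FT (hd : 0 < d) (hs : 0 < s) (hβ : -(d : ℝ) < β) (M : ℕ)
    {u : Ed d → ℂ} (hu : Integrable u) (x : Ed d) (t : ℝ) :
    ∫ ξ, cexp (I * (⟪x, ξ⟫ - t * ‖ξ‖ ^ (2 * s) : ℝ)) * truncAmp d β M ξ * FT u ξ =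
      ∫ y, oscInt s (truncAmp d β M) (x - y) t * u y := by
  have h := integral_integral_swap (f := fun ξ y =>
    cexp (I * (⟪x - y, ξ⟫ - t * ‖ξ‖ ^ (2 * s) : ℝ)) * (truncAmp d β M ξ * u y))
    (integrable_cexp_mul_truncAmp_mul hd hs hβ M hu x t)
  refine Eq.trans ?_ (h.trans ?_)
  · congr 1 with ξ
    rw [FT, ← integral_const_mul]
    congr 1 with y
    rw [inner_sub_left]
    have : cexp (I * (⟪x, ξ⟫ - ⟪y, ξ⟫ - t * ‖ξ‖ ^ (2 * s) : ℝ)) =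
        cexp (I * (⟪x, ξ⟫ - t * ‖ξ‖ ^ (2 * s) : ℝ)) * cexp (-I * (⟪y, ξ⟫ : ℝ)) := by
      rw [← Complex.exp_add]
      congr 1
      push_cast
      ring
    rw [this]
    ring
  · congr 1 with y
    rw [oscInt, ← integral_mul_const]
    congr 1 with ξ
    ring

lemma norm_integral_truncAmp_mul_FT_le (hd : 0 < d) (hs : 0 < s) (hβ : -(d : ℝ) < β) (M : ℕ)
    {u : Ed d → ℂ} (hu : Integrable u) {t K : ℝ}
    (hK : ∀ x : Ed d, ‖oscInt s (truncAmp d β M) x t‖ ≤ K) (x : Ed d) :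
    ‖∫ ξ, cexp (I * (⟪x, ξ⟫ - t * ‖ξ‖ ^ (2 * s) : ℝ)) * truncAmp d β M ξ * FT u ξ‖ ≤
      K * ∫ y, ‖u y‖ := by
  rw [integral_truncAmp_mul_FT hd hs hβ M hu, ← integral_const_mul]
  refine norm_integral_le_of_norm_le (hu.norm.const_mul K) (Filter.Eventually.of_forall fun y => ?_)
  rw [norm_mul]
  gcongr
  exact hK _

lemma continuous_FT {u : Ed d → ℂ} (hu : Integrable u) : Continuous (FT u) := by
  refine continuous_of_dominated (bound := fun y => ‖u y‖) (fun ξ => ?_) (fun ξ => ?_) hu.norm ?_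
  · have h : Continuous fun y : Ed d => cexp (-I * ((⟪y, ξ⟫ : ℝ) : ℂ)) := by fun_prop
    exact h.aestronglyMeasurable.mul hu.aestronglyMeasurable
  · refine Filter.Eventually.of_forall fun y => ?_
    rw [norm_mul, neg_mul, ← mul_neg, ← ofReal_neg, norm_cexp_I_mul_ofReal, one_mul]
  · exact Filter.Eventually.of_forall fun y => by fun_prop

lemma tendsto_truncAmp (β : ℝ) {ξ : Ed d} (hξ : ξ ≠ 0) (hξ2 : ‖ξ‖ ≤ 2) :
    Filter.Tendsto (fun M => truncAmp d β M ξ) Filter.atTop (𝓝 ((‖ξ‖ ^ β : ℝ) : ℂ)) := by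
  refine tendsto_const_nhds.congr' ?_
  have h : Filter.Tendsto (fun M : ℕ => (2 : ℝ) ^ M * ‖ξ‖) Filter.atTop Filter.atTop :=
    (tendsto_pow_atTop_atTop_of_one_lt (by norm_num)).atTop_mul_const (norm_pos_iff.mpr hξ)
  filter_upwards [h.eventually_ge_atTop 4] with M hM
  have h4 : 4 ≤ ‖(2 : ℝ) ^ M • ξ‖ := by rwa [norm_smul, norm_pow, Real.norm_two]
  rw [truncAmp, freqBump_eq_one hξ2, freqBump_eq_zero h4, sub_zero, mul_one]

lemma norm_fracDProp_le (hd : 0 < d) (hs : 0 < s) (hβ : -(d : ℝ) < β)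
    {u : Ed d → ℂ} (hu : Integrable u) (hsupp : ∀ ξ, FT u ξ ≠ 0 → ‖ξ‖ ≤ 2) {t K : ℝ}
    (hK : ∀ (M : ℕ) (x : Ed d), ‖oscInt s (truncAmp d β M) x t‖ ≤ K) (x : Ed d) :
    ‖fracDProp β s t u x‖ ≤ (2 * Real.pi) ^ (-(d : ℝ)) * (K * ∫ y, ‖u y‖) := by
  have : Nonempty (Fin d) := ⟨⟨0, hd⟩⟩
  rw [fracDProp, FTinv, norm_mul, norm_real, Real.norm_of_nonneg (by positivity)]
  gcongr
  have hphase : Continuous fun ξ : Ed d => cexp (I * (⟪x, ξ⟫ - t * ‖ξ‖ ^ (2 * s) : ℝ)) := by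
    have h1 : Continuous fun ξ : Ed d => ‖ξ‖ ^ (2 * s) :=
      continuous_norm.rpow_const fun _ => Or.inr (by positivity)
    fun_prop
  have hlim : Filter.Tendsto (fun M => ∫ ξ, cexp (I * (⟪x, ξ⟫ - t * ‖ξ‖ ^ (2 * s) : ℝ)) *
      truncAmp d β M ξ * FT u ξ) Filter.atTop
      (𝓝 (∫ ξ, cexp (I * ((⟪x, ξ⟫ : ℝ) : ℂ)) * (((‖ξ‖ ^ β : ℝ) : ℂ) *
        cexp (-I * (t : ℂ) * ((‖ξ‖ ^ (2 * s) : ℝ) : ℂ)) * FT u ξ))) := by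
    refine tendsto_integral_of_dominated_convergence
      (fun ξ => (Metric.closedBall (0 : Ed d) 4).indicator (fun ξ => ‖ξ‖ ^ β) ξ * ∫ y, ‖u y‖)
      (fun M => ?_) ((integrable_indicator_norm_rpow hd hβ).mul_const _) (fun M => ?_) ?_
    · exact (hphase.aestronglyMeasurable.mul
        (measurable_truncAmp β M).aestronglyMeasurable).mul
        (continuous_FT hu).aestronglyMeasurable
    · refine Filter.Eventually.of_forall fun ξ => ?_
      rw [norm_mul, norm_mul, norm_cexp_I_mul_ofReal, one_mul]
      exact mul_le_mul (norm_truncAmp_le β M ξ) (norm_FT_le u ξ) (norm_nonneg _)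
        (Set.indicator_nonneg (fun _ _ => by positivity) ξ)
    · filter_upwards [compl_mem_ae_iff.mpr (measure_singleton (0 : Ed d))] with ξ hξ
      by_cases h0 : FT u ξ = 0
      · simp [h0]
      · have hlim := ((tendsto_truncAmp β hξ (hsupp ξ h0)).const_mul
          (cexp (I * (⟪x, ξ⟫ - t * ‖ξ‖ ^ (2 * s) : ℝ)))).mul_const (FT u ξ)
        convert hlim using 2
        have : cexp (I * (⟪x, ξ⟫ - t * ‖ξ‖ ^ (2 * s) : ℝ)) =
            cexp (I * ((⟪x, ξ⟫ : ℝ) : ℂ)) *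
              cexp (-I * (t : ℂ) * ((‖ξ‖ ^ (2 * s) : ℝ) : ℂ)) := by
          rw [← Complex.exp_add]
          congr 1
          push_cast
          ring
        rw [this]
        ring
  exact le_of_tendsto hlim.norm (Filter.Eventually.of_forall fun M =>
    norm_integral_truncAmp_mul_FT_le hd hs hβ M hu (hK M) x)

end Propagator

theorem stmt6 (d : ℕ) (hd : 2 ≤ d) (s : ℝ) (hs : 0 < s) (hs' : s ≠ 1/2)
    (β : ℝ) (hβ : -(d : ℝ) < β) (θ : ℝ) (hθ0 : 0 ≤ θ)
    (hθ : θ ≤ min (((d : ℝ) + β) / (2 * s)) ((d : ℝ) / 2)) :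
    ∃ C : ℝ, 0 < C ∧ ∀ (t : ℝ), t ≠ 0 → ∀ u₀ : SchwartzMap (Ed d) ℂ,
      (∀ ξ : Ed d, FT (⇑u₀) ξ ≠ 0 → ‖ξ‖ ≤ 2) →
      eLpNorm (fracDProp β s t (⇑u₀)) ⊤ volume
        ≤ ENNReal.ofReal (C * |t| ^ (-θ)) * eLpNorm (⇑u₀) 1 volume := by
  have hd0 : 0 < d := by omega
  have hθd : θ ≤ (d : ℝ) / 2 := hθ.trans (min_le_right _ _)
  have hθβ : 2 * s * θ ≤ d + β := by
    have h := hθ.trans (min_le_left _ _)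
    rw [le_div_iff₀ (by positivity)] at h
    linarith
  obtain ⟨K, hK0, hK⟩ := exists_oscInt_truncAmp_le hd0 hs hs' hβ hθ0 hθd hθβ
  refine ⟨(2 * Real.pi) ^ (-(d : ℝ)) * K + 1, by positivity, fun t ht u₀ hsupp => ?_⟩
  have hu : Integrable (⇑u₀) := u₀.integrable
  have hnorm : eLpNorm (⇑u₀) 1 volume = ENNReal.ofReal (∫ y, ‖u₀ y‖) := by
    rw [eLpNorm_one_eq_lintegral_enorm, ofReal_integral_norm_eq_lintegral_enorm hu]
  rw [hnorm, ← ENNReal.ofReal_mul (by positivity), eLpNorm_exponent_top]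
  refine eLpNormEssSup_le_of_ae_bound (Filter.Eventually.of_forall fun x => ?_)
  refine (norm_fracDProp_le hd0 hs hβ hu hsupp (fun M x => hK M x t ht) x).trans ?_
  have h0 : 0 ≤ |t| ^ (-θ) * ∫ y, ‖u₀ y‖ := by positivity
  linarith

end
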